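/- Parity theorem for multiple zeta values: if positive integers k₁,…,k_d with k_d ≥ 2 satisfy k₁+⋯+k_d ≢ d (mod 2), then ζ(k₁,…,k_d) lies in the ℚ[π²]-span of the multiple zeta values of depth at most d−1 (and weight at most k₁+⋯+k_d). -/

import Mathlib

open scoped BigOperators
open Real

/-- The multiple zeta value `ζ(k₁,…,k_d) = ∑_{0<m₁<⋯<m_d} ∏ 1/m_i^{k_i}`
(as a `tsum` over strictly increasing tuples of positive integers). -/
noncomputable def MZV (k : List ℕ) : ℝ :=
  ∑' m : {f : Fin k.length → ℕ+ // StrictMono f}, ∏ i, 1 / ((m.1 i : ℕ) : ℝ) ^ k.get i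

/-- The stuffle (quasi-shuffle) product of two words, as a multiset of words. -/
def stuffle : List ℕ → List ℕ → Multiset (List ℕ)
  | [], v => {v}
  | u, [] => {u}
  | a :: u, b :: v =>
      (stuffle u (b :: v)).map (a :: ·) + (stuffle (a :: u) v).map (b :: ·) +
        (stuffle u v).map ((a + b) :: ·)
  termination_by u v => u.length + v.length

/-- All contractions of a word: the results of replacing each comma by `,` or `+`. -/
def contractions : List ℕ → Multiset (List ℕ)
  | [] => {[]}
  | [a] => {[a]}
  | a :: b :: t => (contractions (b :: t)).map (a :: ·) + contractions ((a + b) :: t)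
  termination_by l => l.length

/-- `Z` is a stuffle (harmonic) regularization of multiple zeta values:
it takes the value `1` on the empty word, agrees with the convergent multiple zeta
values on admissible words, and is a homomorphism for the stuffle product. -/
structure IsStuffleReg (Z : List ℕ → ℝ) : Prop where
  empty : Z [] = 1
  conv : ∀ l : List ℕ, (∀ i ∈ l, 0 < i) → 2 ≤ l.getLastD 2 → Z l = MZV l
  mul : ∀ u v : List ℕ, (∀ i ∈ u, 0 < i) → (∀ i ∈ v, 0 < i) →
    Z u * Z v = ((stuffle u v).map Z).sum

/-- The star version `ζ^{⋆,*}(k₁,…,k_d)`: the sum of `Z` over all contractions. -/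
noncomputable def zetaStarOf (Z : List ℕ → ℝ) (l : List ℕ) : ℝ :=
  ((contractions l).map Z).sum

/-- `ζ_a^*(l₁,…,l_r) = (-1)^a ∑_{a₁+⋯+a_r=a} ζ^*(l₁+a₁,…,l_r+a_r) ∏ C(l_i-1+a_i,a_i)`. -/
noncomputable def zetaA (Z : List ℕ → ℝ) (a : ℕ) (l : List ℕ) : ℝ :=
  (-1 : ℝ) ^ a *
    ∑ f ∈ (Fintype.piFinset fun _ : Fin l.length => Finset.range (a + 1)).filter
        (fun f => ∑ i, f i = a),
      Z (List.ofFn fun i => l.get i + f i) *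
        ∏ i, (Nat.choose (l.get i - 1 + f i) (f i) : ℝ)

/-- `δ^{k₁,…,k_d}`: equal to `(-1)^n π^{2n}/(2n)!` if `(k₁,…,k_d) = (1,…,1)` has even
length `2n`, and `0` otherwise. -/
noncomputable def deltaVal (l : List ℕ) : ℝ :=
  if l.all (· = 1) ∧ l.length % 2 = 0 then
    (-1 : ℝ) ^ (l.length / 2) * π ^ l.length / (Nat.factorial l.length) else 0

namespace MZVParity
open Filter Topology

/-- The strictly increasing integer lists of length `d` with entries in `(a, b]`. -/
noncomputable def chains : ℕ → ℤ → ℤ → Finset (List ℤ)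
  | 0, _, _ => {[]}
  | d + 1, a, b => (Finset.Ioc a b).biUnion fun m => (chains d m b).image (m :: ·)

lemma mem_chains {d : ℕ} {a b : ℤ} {l : List ℤ} :
    l ∈ chains d a b ↔ l.length = d ∧ l.Pairwise (· < ·) ∧ ∀ x ∈ l, a < x ∧ x ≤ b := by
  induction d generalizing a l with
  | zero =>
    simp only [chains, Finset.mem_singleton]
    constructor
    · rintro rfl; simp
    · rintro ⟨h, -⟩; exact List.length_eq_zero_iff.1 h
  | succ d ih =>
    simp only [chains, Finset.mem_biUnion, Finset.mem_Ioc, Finset.mem_image]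
    constructor
    · rintro ⟨m, hm, t, ht, rfl⟩
      obtain ⟨h1, h2, h3⟩ := ih.1 ht
      refine ⟨by simp [h1], List.pairwise_cons.2 ⟨fun x hx => (h3 x hx).1, h2⟩, ?_⟩
      intro x hx
      rcases List.mem_cons.1 hx with rfl | hx
      · exact hm
      · exact ⟨hm.1.trans (h3 x hx).1, (h3 x hx).2⟩
    · rintro ⟨h1, h2, h3⟩
      cases l with
      | nil => simp at h1
      | cons m t =>
        rw [List.pairwise_cons] at h2
        refine ⟨m, h3 m (by simp), t, ih.2 ⟨by simpa using h1, h2.2, fun x hx => ?_⟩, rfl⟩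
        exact ⟨h2.1 x hx, (h3 x (by simp [hx])).2⟩

lemma sum_chains_zero {E : Type*} [AddCommMonoid E] (a b : ℤ) (F : List ℤ → E) :
    ∑ l ∈ chains 0 a b, F l = F [] := by
  simp [chains]

lemma sum_chains_succ {E : Type*} [AddCommMonoid E] (d : ℕ) (a b : ℤ) (F : List ℤ → E) :
    ∑ l ∈ chains (d + 1) a b, F l = ∑ m ∈ Finset.Ioc a b, ∑ t ∈ chains d m b, F (m :: t) := by
  rw [chains, Finset.sum_biUnion]
  · refine Finset.sum_congr rfl fun m _ => ?_
    rw [Finset.sum_image]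
    intro x _ y _ h
    simpa using h
  · intro x _ y _ hxy
    refine Finset.disjoint_left.2 fun l hl hl' => ?_
    simp only [Finset.mem_image] at hl hl'
    obtain ⟨t, -, rfl⟩ := hl
    obtain ⟨t', -, h⟩ := hl'
    simp only [List.cons.injEq] at h
    exact hxy h.1.symm

/-- The monomial `∏ 1 / m_i ^ k_i`. -/
noncomputable def invMonomial (m : List ℤ) (k : List ℕ) : ℝ :=
  (List.zipWith (fun (x : ℤ) (e : ℕ) => ((x : ℝ)⁻¹) ^ e) m k).prod

@[simp] lemma invMonomial_nil (k : List ℕ) : invMonomial [] k = 1 := by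
  simp [invMonomial]

@[simp] lemma invMonomial_cons (x : ℤ) (m : List ℤ) (e : ℕ) (k : List ℕ) :
    invMonomial (x :: m) (e :: k) = ((x : ℝ)⁻¹) ^ e * invMonomial m k := by
  simp [invMonomial]

lemma invMonomial_append {m m' : List ℤ} {k k' : List ℕ} (h : m.length = k.length) :
    invMonomial (m ++ m') (k ++ k') = invMonomial m k * invMonomial m' k' := by
  simp [invMonomial, List.zipWith_append h]

/-- Multiple harmonic sums over `a < m₁ < ⋯ < m_d ≤ b`. -/
noncomputable def hsum : List ℕ → ℤ → ℤ → ℝ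
  | [], _, _ => 1
  | e :: k, a, b => ∑ m ∈ Finset.Ioc a b, ((m : ℝ)⁻¹) ^ e * hsum k m b

lemma hsum_eq_sum_chains (k : List ℕ) (a b : ℤ) :
    hsum k a b = ∑ l ∈ chains k.length a b, invMonomial l k := by
  induction k generalizing a with
  | nil => simp [hsum, sum_chains_zero]
  | cons e k ih =>
    rw [hsum, List.length_cons, sum_chains_succ]
    refine Finset.sum_congr rfl fun m _ => ?_
    rw [ih, Finset.mul_sum]
    simp

lemma sum_Ioc_mul_sum_Ioc (a b : ℤ) (f g : ℤ → ℝ) :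
    (∑ m ∈ Finset.Ioc a b, f m) * ∑ m ∈ Finset.Ioc a b, g m =
      (∑ m ∈ Finset.Ioc a b, f m * ∑ n ∈ Finset.Ioc m b, g n) +
      (∑ m ∈ Finset.Ioc a b, g m * ∑ n ∈ Finset.Ioc m b, f n) +
      ∑ m ∈ Finset.Ioc a b, f m * g m := by
  have h1 : ∀ f : ℤ → ℝ, ∀ m ∈ Finset.Ioc a b, ∑ n ∈ Finset.Ioc m b, f n =
      ∑ n ∈ Finset.Ioc a b, if m < n then f n else 0 := by
    intro f m hm
    rw [← Finset.sum_filter]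
    refine Finset.sum_congr ?_ fun _ _ => rfl
    ext n
    simp only [Finset.mem_Ioc, Finset.mem_filter] at hm ⊢
    omega
  have e1 : (∑ m ∈ Finset.Ioc a b, f m * ∑ n ∈ Finset.Ioc m b, g n) =
      ∑ m ∈ Finset.Ioc a b, ∑ n ∈ Finset.Ioc a b, if m < n then f m * g n else 0 := by
    refine Finset.sum_congr rfl fun m hm => ?_
    rw [h1 g m hm, Finset.mul_sum]
    simp
  have e2 : (∑ m ∈ Finset.Ioc a b, g m * ∑ n ∈ Finset.Ioc m b, f n) =
      ∑ m ∈ Finset.Ioc a b, ∑ n ∈ Finset.Ioc a b, if n < m then f m * g n else 0 := by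
    rw [Finset.sum_comm]
    refine Finset.sum_congr rfl fun m hm => ?_
    rw [h1 f m hm, Finset.mul_sum]
    simp [mul_comm]
  have e3 : (∑ m ∈ Finset.Ioc a b, f m * g m) =
      ∑ m ∈ Finset.Ioc a b, ∑ n ∈ Finset.Ioc a b, if m = n then f m * g n else 0 := by
    refine Finset.sum_congr rfl fun m hm => ?_
    rw [Finset.sum_ite_eq, if_pos hm]
  rw [e1, e2, e3, Finset.sum_mul_sum, ← Finset.sum_add_distrib, ← Finset.sum_add_distrib]
  refine Finset.sum_congr rfl fun m _ => ?_
  rw [← Finset.sum_add_distrib, ← Finset.sum_add_distrib]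
  refine Finset.sum_congr rfl fun n _ => ?_
  rcases lt_trichotomy m n with h | h | h
  · simp [h, h.ne, h.not_gt]
  · simp [h]
  · simp [h, h.ne', h.not_gt]

/-- Peaks pointing down: the smallest variable carries the exponent `e`. -/
noncomputable def vsum (u : List ℕ) (e : ℕ) (v : List ℕ) (a b : ℤ) : ℝ :=
  ∑ m ∈ Finset.Ioc a b, ((m : ℝ)⁻¹) ^ e * (hsum u m b * hsum v m b)

lemma hsum_cons_mul_hsum_cons (x : ℕ) (u : List ℕ) (y : ℕ) (v : List ℕ) (a b : ℤ) :
    hsum (x :: u) a b * hsum (y :: v) a b =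
      vsum u x (y :: v) a b + vsum (x :: u) y v a b + vsum u (x + y) v a b := by
  have h := sum_Ioc_mul_sum_Ioc a b (fun m => ((m : ℝ)⁻¹) ^ x * hsum u m b)
    (fun m => ((m : ℝ)⁻¹) ^ y * hsum v m b)
  simp only [vsum]
  rw [hsum, hsum, h]
  congr 1
  · congr 1
    · refine Finset.sum_congr rfl fun m _ => ?_
      rw [hsum]; ring
    · refine Finset.sum_congr rfl fun m _ => ?_
      rw [hsum]; ring
  · refine Finset.sum_congr rfl fun m _ => ?_
    rw [pow_add]; ring

lemma sum_map_hsum_cons (S : Multiset (List ℕ)) (x : ℕ) (a b : ℤ) :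
    ((S.map (x :: ·)).map (hsum · a b)).sum =
      ∑ m ∈ Finset.Ioc a b, ((m : ℝ)⁻¹) ^ x * (S.map (hsum · m b)).sum := by
  induction S using Multiset.induction with
  | empty => simp
  | cons s S ih =>
    simp only [Multiset.map_cons, Multiset.sum_cons, ih, mul_add, Finset.sum_add_distrib]
    rw [hsum]

lemma hsum_mul_hsum (u v : List ℕ) (a b : ℤ) :
    hsum u a b * hsum v a b = ((stuffle u v).map (hsum · a b)).sum := by
  induction u, v using stuffle.induct generalizing a with
  | case1 v => simp [stuffle, hsum]
  | case2 u h =>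
    cases u with
    | nil => simp [stuffle, hsum]
    | cons x u => simp [stuffle, hsum]
  | case3 x u y v ih1 ih2 ih3 =>
    rw [hsum_cons_mul_hsum_cons, stuffle, Multiset.map_add, Multiset.map_add, Multiset.sum_add,
      Multiset.sum_add, sum_map_hsum_cons, sum_map_hsum_cons, sum_map_hsum_cons]
    simp only [← ih1, ← ih2, ← ih3, vsum]

lemma vsum_eq (u : List ℕ) (e : ℕ) (v : List ℕ) (a b : ℤ) :
    vsum u e v a b = ((stuffle u v).map (fun w => hsum (e :: w) a b)).sum := by
  have := sum_map_hsum_cons (stuffle u v) e a b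
  rw [Multiset.map_map] at this
  simp only [vsum, hsum_mul_hsum]
  exact this.symm

/-- A word is admissible when its multiple zeta value converges. -/
def Admissible (l : List ℕ) : Prop := (∀ i ∈ l, 0 < i) ∧ 2 ≤ l.getLastD 2

lemma length_pos_sum_of_mem_stuffle {u v w : List ℕ} (hw : w ∈ stuffle u v)
    (hu : ∀ i ∈ u, 0 < i) (hv : ∀ i ∈ v, 0 < i) :
    w.length ≤ u.length + v.length ∧ (∀ i ∈ w, 0 < i) ∧ w.sum = u.sum + v.sum := by
  induction u, v using stuffle.induct generalizing w with
  | case1 v =>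
    simp only [stuffle, Multiset.mem_singleton] at hw
    subst hw; simpa using hv
  | case2 u h =>
    have : stuffle u [] = {u} := by cases u <;> simp [stuffle]
    rw [this, Multiset.mem_singleton] at hw
    subst hw; simpa using hu
  | case3 x u y v ih1 ih2 ih3 =>
    rw [stuffle, Multiset.mem_add, Multiset.mem_add, Multiset.mem_map, Multiset.mem_map,
      Multiset.mem_map] at hw
    simp only [List.mem_cons, forall_eq_or_imp] at hu hv ih1 ih2 ih3
    rcases hw with (⟨t, ht, rfl⟩ | ⟨t, ht, rfl⟩) | ⟨t, ht, rfl⟩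
    · have := ih1 ht hu.2 hv
      simp only [List.length_cons, List.mem_cons, forall_eq_or_imp, List.sum_cons] at this ⊢
      exact ⟨by omega, ⟨hu.1, this.2.1⟩, by omega⟩
    · have := ih2 ht hu hv.2
      simp only [List.length_cons, List.mem_cons, forall_eq_or_imp, List.sum_cons] at this ⊢
      exact ⟨by omega, ⟨hv.1, this.2.1⟩, by omega⟩
    · have := ih3 ht hu.2 hv.2
      simp only [List.length_cons, List.mem_cons, forall_eq_or_imp, List.sum_cons] at this ⊢
      exact ⟨by omega, ⟨by omega, this.2.1⟩, by omega⟩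

lemma getLastD_cons_self (x c : ℕ) (l : List ℕ) (hl : l ≠ []) :
    (x :: l).getLastD c = l.getLastD c := by
  cases l with
  | nil => exact absurd rfl hl
  | cons y l => simp [List.getLastD]

lemma two_le_getLastD_of_mem_stuffle {u v w : List ℕ} (hw : w ∈ stuffle u v)
    (hu : 2 ≤ u.getLastD 2) (hv : 2 ≤ v.getLastD 2) :
    2 ≤ w.getLastD 2 ∧ (w = [] → u = [] ∧ v = []) := by
  induction u, v using stuffle.induct generalizing w with
  | case1 v =>
    simp only [stuffle, Multiset.mem_singleton] at hw
    subst hw; exact ⟨hv, by simp⟩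
  | case2 u h =>
    have : stuffle u [] = {u} := by cases u <;> simp [stuffle]
    rw [this, Multiset.mem_singleton] at hw
    subst hw; exact ⟨hu, by simp⟩
  | case3 x u y v ih1 ih2 ih3 =>
    have hc : ∀ (z : ℕ) (t : List ℕ), 2 ≤ (z :: t).getLastD 2 → 2 ≤ t.getLastD 2 := by
      intro z t h
      cases t with
      | nil => simp
      | cons s t => rwa [getLastD_cons_self _ _ _ (by simp)] at h
    rw [stuffle, Multiset.mem_add, Multiset.mem_add, Multiset.mem_map, Multiset.mem_map,
      Multiset.mem_map] at hw
    refine ⟨?_, ?_⟩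
    · rcases hw with (⟨t, ht, rfl⟩ | ⟨t, ht, rfl⟩) | ⟨t, ht, rfl⟩
      · have := ih1 ht (hc _ _ hu) hv
        rw [getLastD_cons_self _ _ _ (fun h => by simpa using this.2 h)]
        exact this.1
      · have := ih2 ht hu (hc _ _ hv)
        rw [getLastD_cons_self _ _ _ (fun h => by simpa using this.2 h)]
        exact this.1
      · have := ih3 ht (hc _ _ hu) (hc _ _ hv)
        by_cases h : t = []
        · obtain ⟨rfl, rfl⟩ := this.2 h
          subst h
          simp at hu hv ⊢
          omega
        · rw [getLastD_cons_self _ _ _ h]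
          exact this.1
    · rintro rfl
      simp at hw

lemma Admissible.of_mem_stuffle {u v w : List ℕ} (hw : w ∈ stuffle u v)
    (hu : Admissible u) (hv : Admissible v) : Admissible w :=
  ⟨(length_pos_sum_of_mem_stuffle hw hu.1 hv.1).2.1, (two_le_getLastD_of_mem_stuffle hw hu.2 hv.2).1⟩

/-- The harmonic numbers. -/
noncomputable def harm (M : ℕ) : ℝ := hsum [1] 0 M

lemma harm_eq_sum (M : ℕ) : harm M = ∑ m ∈ Finset.Ioc (0 : ℤ) M, (m : ℝ)⁻¹ := by
  simp [harm, hsum]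

lemma sum_Ioc_succ (f : ℤ → ℝ) (M : ℕ) :
    ∑ m ∈ Finset.Ioc (0 : ℤ) (M + 1 : ℕ), f m = ∑ m ∈ Finset.Ioc (0 : ℤ) M, f m + f (M + 1) := by
  have : Finset.Ioc (0 : ℤ) (M + 1 : ℕ) = insert ((M : ℤ) + 1) (Finset.Ioc (0 : ℤ) M) := by
    ext x; simp only [Finset.mem_Ioc, Finset.mem_insert]; push_cast; omega
  rw [this, Finset.sum_insert (by simp), add_comm]

lemma harm_eq_harmonic (M : ℕ) : harm M = (harmonic M : ℝ) := by
  induction M with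
  | zero => simp [harm_eq_sum]
  | succ M ih =>
    rw [harm_eq_sum, sum_Ioc_succ, ← harm_eq_sum, ih, harmonic_succ]
    push_cast; ring

lemma harm_nonneg (M : ℕ) : 0 ≤ harm M := by
  rw [harm_eq_sum]
  refine Finset.sum_nonneg fun m hm => ?_
  have : 0 < m := (Finset.mem_Ioc.1 hm).1
  positivity

lemma tendsto_harm : Tendsto harm atTop atTop := by
  refine tendsto_atTop_mono (f := fun n : ℕ => Real.log ((n : ℝ) + 1)) (fun n => ?_) ?_
  · rw [harm_eq_harmonic]
    have := log_add_one_le_harmonic n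
    exact_mod_cast this
  · exact Real.tendsto_log_atTop.comp
      (tendsto_atTop_add_const_right _ _ tendsto_natCast_atTop_atTop)

lemma harm_le (M : ℕ) : harm M ≤ 2 * Real.log (√(Real.exp 1 * (M + 1))) := by
  rw [harm_eq_harmonic, Real.log_sqrt (by positivity), Real.log_mul (by positivity) (by positivity),
    Real.log_exp]
  have h1 := harmonic_le_one_add_log M
  have h2 : Real.log M ≤ Real.log (M + 1) := by
    rcases Nat.eq_zero_or_pos M with rfl | h
    · simp
    · exact Real.log_le_log (by exact_mod_cast h) (by linarith)
  linarith

lemma tendsto_harm_pow_div_sqrt (q : ℕ) :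
    Tendsto (fun M : ℕ => harm M ^ q / √((M : ℝ) + 1)) atTop (𝓝 0) := by
  set z : ℕ → ℝ := fun M => √(Real.exp 1 * ((M : ℝ) + 1)) with hz
  have hzt : Tendsto z atTop atTop := by
    refine Real.tendsto_sqrt_atTop.comp ?_
    exact Tendsto.const_mul_atTop (Real.exp_pos 1)
      (tendsto_atTop_add_const_right _ _ tendsto_natCast_atTop_atTop)
  have h1 : Tendsto (fun x : ℝ => Real.log x ^ q / x) atTop (𝓝 0) :=
    (isLittleO_pow_log_id_atTop (n := q)).tendsto_div_nhds_zero
  have h2 := ((h1.comp hzt).const_mul (2 ^ q * √(Real.exp 1)))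
  rw [mul_zero] at h2
  refine squeeze_zero (fun M => by have := harm_nonneg M; positivity) (fun M => ?_) h2
  have h3 : z M = √(Real.exp 1) * √((M : ℝ) + 1) := Real.sqrt_mul (Real.exp_pos 1).le _
  have h4 : harm M ^ q ≤ 2 ^ q * Real.log (z M) ^ q := by
    rw [← mul_pow]
    exact pow_le_pow_left₀ (harm_nonneg M) (harm_le M) q
  have h5 : (0 : ℝ) < √((M : ℝ) + 1) := Real.sqrt_pos.2 (by positivity)
  have h6 : (0 : ℝ) < √(Real.exp 1) := Real.sqrt_pos.2 (Real.exp_pos 1)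
  calc harm M ^ q / √((M : ℝ) + 1) ≤ 2 ^ q * Real.log (z M) ^ q / √((M : ℝ) + 1) := by gcongr
    _ = _ := by
      simp only [Function.comp]
      rw [h3]
      field_simp

/-- Sequences that stay negligible after multiplication by any power of the harmonic numbers. -/
noncomputable def negligible : Submodule ℝ (ℕ → ℝ) where
  carrier := {e | ∀ j : ℕ, Tendsto (fun M => e M * harm M ^ j) atTop (𝓝 0)}
  add_mem' := by
    intro e f he hf j
    simpa [add_mul] using (he j).add (hf j)
  zero_mem' := by intro j; simp
  smul_mem' := by
    intro c e he j
    simpa [mul_assoc] using (he j).const_mul c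

lemma negligible_of_abs_le {e : ℕ → ℝ} (C : ℝ) (q : ℕ)
    (h : ∀ M : ℕ, 0 < M → |e M| ≤ C * (harm M ^ q / √((M : ℝ) + 1))) : e ∈ negligible := by
  intro j
  have h1 := (tendsto_harm_pow_div_sqrt (q + j)).const_mul C
  rw [mul_zero] at h1
  refine squeeze_zero_norm' ?_ h1
  filter_upwards [eventually_gt_atTop 0] with M hM
  rw [norm_mul, Real.norm_eq_abs, Real.norm_eq_abs, abs_of_nonneg (pow_nonneg (harm_nonneg M) j)]
  calc |e M| * harm M ^ j ≤ C * (harm M ^ q / √((M : ℝ) + 1)) * harm M ^ j :=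
        mul_le_mul_of_nonneg_right (h M hM) (pow_nonneg (harm_nonneg M) j)
    _ = _ := by rw [pow_add]; ring

lemma negligible_of_abs_le_div {e : ℕ → ℝ} (C : ℝ) (q : ℕ) (hC : 0 ≤ C)
    (h : ∀ M : ℕ, 0 < M → |e M| ≤ C * harm M ^ q / M) : e ∈ negligible := by
  refine negligible_of_abs_le (2 * C) q fun M hM => (h M hM).trans ?_
  have h1 : (1 : ℝ) ≤ M := by exact_mod_cast hM
  have h2 : √((M : ℝ) + 1) ≤ 2 * M := Real.sqrt_le_iff.2 ⟨by positivity, by nlinarith⟩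
  have h5 : (0 : ℝ) < √((M : ℝ) + 1) := Real.sqrt_pos.2 (by positivity)
  have h6 := pow_nonneg (harm_nonneg M) q
  calc C * harm M ^ q / M = 2 * C * (harm M ^ q / (2 * M)) := by field_simp
    _ ≤ _ := by gcongr

lemma negligible.mul {e f : ℕ → ℝ} (he : e ∈ negligible) (hf : f ∈ negligible) :
    e * f ∈ negligible := by
  intro j
  simpa [mul_assoc] using (he 0).mul (hf j)

lemma negligible.mul_eval {e : ℕ → ℝ} (he : e ∈ negligible) (P : Polynomial ℝ) :
    (fun M => e M * P.eval (harm M)) ∈ negligible := by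
  induction P using Polynomial.induction_on' with
  | add p q hp hq =>
    have := negligible.add_mem hp hq
    convert this using 1
    ext M; simp [mul_add]
  | monomial n a =>
    intro j
    have := (he (n + j)).const_mul a
    rw [mul_zero] at this
    convert this using 1
    ext M
    simp only [Polynomial.eval_monomial]
    rw [pow_add]; ring

lemma eq_C_of_negligible {P : Polynomial ℝ} {c : ℝ}
    (h : (fun M => c - P.eval (harm M)) ∈ negligible) : P = Polynomial.C c := by
  set Q := P - Polynomial.C c with hQ
  have h0 : Tendsto (fun M => Q.eval (harm M)) atTop (𝓝 0) := by
    have := (h 0).neg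
    simp only [neg_zero, pow_zero, mul_one] at this
    convert this using 1
    ext M; simp [hQ]
  have hd : Q.degree ≤ 0 := by
    by_contra! hd
    have := (Polynomial.abs_tendsto_atTop Q hd).comp tendsto_harm
    exact not_tendsto_nhds_of_tendsto_atTop this _ h0.abs
  rw [Polynomial.eq_C_of_degree_le_zero hd] at h0
  simp only [Polynomial.eval_C] at h0
  have h1 : Q.coeff 0 = 0 := tendsto_nhds_unique tendsto_const_nhds h0
  have : Q = 0 := by rw [Polynomial.eq_C_of_degree_le_zero hd, h1, Polynomial.C_0]
  exact sub_eq_zero.1 this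

lemma hsum_nonneg (k : List ℕ) (a b : ℤ) (ha : 0 ≤ a) : 0 ≤ hsum k a b := by
  induction k generalizing a with
  | nil => simp [hsum]
  | cons e k ih =>
    rw [hsum]
    refine Finset.sum_nonneg fun m hm => ?_
    have : 0 < m := ha.trans_lt (Finset.mem_Ioc.1 hm).1
    have := ih m this.le
    positivity

lemma inv_pow_le_inv {m : ℤ} (hm : 0 < m) {e : ℕ} (he : 0 < e) : ((m : ℝ)⁻¹) ^ e ≤ (m : ℝ)⁻¹ := by
  have h1 : (1 : ℝ) ≤ m := by exact_mod_cast hm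
  calc ((m : ℝ)⁻¹) ^ e ≤ ((m : ℝ)⁻¹) ^ 1 :=
        pow_le_pow_of_le_one (by positivity) (inv_le_one_of_one_le₀ h1) he
    _ = _ := pow_one _

lemma inv_pow_le_inv_sq {m : ℤ} (hm : 0 < m) {e : ℕ} (he : 2 ≤ e) :
    ((m : ℝ)⁻¹) ^ e ≤ ((m : ℝ)⁻¹) ^ 2 := by
  have h1 : (1 : ℝ) ≤ m := by exact_mod_cast hm
  exact pow_le_pow_of_le_one (by positivity) (inv_le_one_of_one_le₀ h1) he

lemma sum_Ioc_le_harm {a : ℤ} (ha : 0 ≤ a) (M : ℕ) :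
    ∑ m ∈ Finset.Ioc a (M : ℤ), (m : ℝ)⁻¹ ≤ harm M := by
  rw [harm_eq_sum]
  refine Finset.sum_le_sum_of_subset_of_nonneg (Finset.Ioc_subset_Ioc_left ha) fun m hm _ => ?_
  have : 0 < m := (Finset.mem_Ioc.1 hm).1
  positivity

lemma hsum_le_harm_pow (k : List ℕ) (hk : ∀ i ∈ k, 0 < i) {a : ℤ} (ha : 0 ≤ a) (M : ℕ) :
    hsum k a M ≤ harm M ^ k.length := by
  induction k generalizing a with
  | nil => simp [hsum]
  | cons e k ih =>
    simp only [List.mem_cons, forall_eq_or_imp] at hk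
    rw [hsum, List.length_cons, pow_succ']
    calc ∑ m ∈ Finset.Ioc a (M : ℤ), ((m : ℝ)⁻¹) ^ e * hsum k m M
        ≤ ∑ m ∈ Finset.Ioc a (M : ℤ), (m : ℝ)⁻¹ * harm M ^ k.length := by
          refine Finset.sum_le_sum fun m hm => ?_
          have h0 : 0 < m := ha.trans_lt (Finset.mem_Ioc.1 hm).1
          exact mul_le_mul (inv_pow_le_inv h0 hk.1) (ih hk.2 h0.le) (hsum_nonneg _ _ _ h0.le)
            (by positivity)
      _ ≤ _ := by
          rw [← Finset.sum_mul]
          exact mul_le_mul_of_nonneg_right (sum_Ioc_le_harm ha M) (pow_nonneg (harm_nonneg M) _)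

lemma hsum_append_singleton (k : List ℕ) (e : ℕ) (a b : ℤ) :
    hsum (k ++ [e]) a b = ∑ m ∈ Finset.Ioc a b, hsum k a (m - 1) * ((m : ℝ)⁻¹) ^ e := by
  induction k generalizing a with
  | nil => simp [hsum]
  | cons x k ih =>
    simp only [List.cons_append, hsum, ih, Finset.mul_sum, Finset.sum_mul]
    rw [Finset.sum_comm' (t' := Finset.Ioc a b) (s' := fun y => Finset.Ioc a (y - 1))]
    · refine Finset.sum_congr rfl fun m _ => Finset.sum_congr rfl fun n _ => by ring
    · intro x y
      simp only [Finset.mem_Ioc]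
      omega

lemma hsum_succ (k : List ℕ) (e : ℕ) (M : ℕ) :
    hsum (k ++ [e]) 0 (M + 1 : ℕ) = hsum (k ++ [e]) 0 M + hsum k 0 M * (((M : ℝ) + 1)⁻¹) ^ e := by
  rw [hsum_append_singleton, sum_Ioc_succ, ← hsum_append_singleton]
  simp

lemma exists_hsum_succ_le (k : List ℕ) (hk : ∀ i ∈ k, 0 < i) (e : ℕ) (he : 2 ≤ e) :
    ∃ C : ℝ, 0 ≤ C ∧ ∀ M : ℕ, 0 < M → hsum (k ++ [e]) 0 (M + 1 : ℕ) - hsum (k ++ [e]) 0 M ≤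
      C * (1 / √(M : ℝ) - 1 / √((M : ℝ) + 1)) := by
  obtain ⟨C, hC⟩ := (tendsto_harm_pow_div_sqrt k.length).bddAbove_range
  have hC' : ∀ M : ℕ, harm M ^ k.length / √((M : ℝ) + 1) ≤ C := fun M => hC ⟨M, rfl⟩
  have hC0 : 0 ≤ C := le_trans (by have := harm_nonneg 0; positivity) (hC' 0)
  refine ⟨2 * C, by positivity, fun M hM => ?_⟩
  have hM1 : (0 : ℝ) < M := by exact_mod_cast hM
  set s := √(M : ℝ) with hs
  set t := √((M : ℝ) + 1) with ht
  have hs0 : 0 < s := Real.sqrt_pos.2 hM1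
  have ht0 : 0 < t := Real.sqrt_pos.2 (by positivity)
  have hs2 : s ^ 2 = M := Real.sq_sqrt hM1.le
  have ht2 : t ^ 2 = M + 1 := Real.sq_sqrt (by positivity)
  have hst : s ≤ t := Real.sqrt_le_sqrt (by linarith)
  have h1 : hsum k 0 M ≤ C * t := by
    have := hC' M
    rw [div_le_iff₀ ht0] at this
    exact (hsum_le_harm_pow k hk le_rfl M).trans this
  have h2 : (((M : ℝ) + 1)⁻¹) ^ e ≤ (t ^ 4)⁻¹ := by
    have := inv_pow_le_inv_sq (m := (M : ℤ) + 1) (by positivity) he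
    push_cast at this
    refine this.trans (le_of_eq ?_)
    rw [← ht2, ← inv_pow, ← inv_pow]; ring
  rw [hsum_succ]
  calc _ = hsum k 0 M * (((M : ℝ) + 1)⁻¹) ^ e := by ring
    _ ≤ C * t * (t ^ 4)⁻¹ := mul_le_mul h1 h2 (by positivity) (by positivity)
    _ = C * (1 / t ^ 3) := by field_simp
    _ ≤ C * (2 * (1 / s - 1 / t)) := by
      refine mul_le_mul_of_nonneg_left ?_ hC0
      rw [div_sub_div _ _ hs0.ne' ht0.ne', ← mul_div_assoc, div_le_div_iff₀ (by positivity) (by positivity)]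
      have h3 : (t - s) * (t + s) = 1 := by ring_nf; rw [hs2, ht2]; ring
      have h4 : 1 ≤ (t - s) * (2 * t) := by rw [← h3]; nlinarith
      have h5 : s * t ≤ t ^ 2 := by nlinarith
      nlinarith [pow_pos ht0 2]
    _ = _ := by ring

lemma exists_hsum_le (k : List ℕ) (hk : ∀ i ∈ k, 0 < i) (e : ℕ) (he : 2 ≤ e) :
    ∃ C : ℝ, 0 ≤ C ∧ ∀ M N : ℕ, 0 < M → M ≤ N → hsum (k ++ [e]) 0 N - hsum (k ++ [e]) 0 M ≤
      C * (1 / √(M : ℝ) - 1 / √(N : ℝ)) := by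
  obtain ⟨C, hC0, hC⟩ := exists_hsum_succ_le k hk e he
  refine ⟨C, hC0, fun M N hM hMN => ?_⟩
  induction N, hMN using Nat.le_induction with
  | base => simp
  | succ N hN ih =>
    have := hC N (hM.trans_le hN)
    push_cast at this ⊢
    linarith

lemma hsum_mono (k : List ℕ) {M N : ℕ} (h : M ≤ N) : hsum k 0 M ≤ hsum k 0 N := by
  rw [hsum_eq_sum_chains, hsum_eq_sum_chains]
  have hpos : ∀ l ∈ chains k.length 0 N, 0 ≤ invMonomial l k := by
    intro l hl
    obtain ⟨-, -, h3⟩ := mem_chains.1 hl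
    refine List.prod_nonneg fun x hx => ?_
    rw [List.zipWith_eq_zipWith_take_min, ← List.map_uncurry_zip_eq_zipWith] at hx
    simp only [List.mem_map] at hx
    obtain ⟨⟨y, e⟩, hy, rfl⟩ := hx
    have := (h3 y (List.mem_of_mem_take (List.of_mem_zip hy).1)).1
    simp only [Function.uncurry]
    positivity
  refine Finset.sum_le_sum_of_subset_of_nonneg ?_ fun l hl _ => hpos l hl
  intro l hl
  rw [mem_chains] at hl ⊢
  refine ⟨hl.1, hl.2.1, fun x hx => ⟨(hl.2.2 x hx).1, (hl.2.2 x hx).2.trans (by exact_mod_cast h)⟩⟩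

lemma invMonomial_ofFn (k : List ℕ) (g : Fin k.length → ℤ) :
    invMonomial (List.ofFn g) k = ∏ i, ((g i : ℝ)⁻¹) ^ k.get i := by
  rw [invMonomial, ← List.prod_ofFn]
  congr 1
  apply List.ext_getElem
  · simp
  · intro i h1 h2
    simp

lemma tendsto_hsum_MZV (k : List ℕ) (C : ℝ) (hC : ∀ M : ℕ, hsum k 0 M ≤ C) :
    Tendsto (fun M : ℕ => hsum k 0 M) atTop (𝓝 (MZV k)) := by
  set φ : {f : Fin k.length → ℕ+ // StrictMono f} → List ℤ :=
    fun m => List.ofFn fun i => ((m.1 i : ℕ) : ℤ) with hφ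
  have hinj : Function.Injective φ := by
    intro m m' h
    have := List.ofFn_injective h
    ext i
    have := congrFun this i
    exact_mod_cast this
  have hval : ∀ m, invMonomial (φ m) k = ∏ i, 1 / ((m.1 i : ℕ) : ℝ) ^ k.get i := by
    intro m
    rw [hφ, invMonomial_ofFn]
    simp
  set s : ℕ → Finset {f : Fin k.length → ℕ+ // StrictMono f} :=
    fun M => (chains k.length 0 M).preimage φ hinj.injOn with hs
  have hsum_s : ∀ M : ℕ, ∑ m ∈ s M, ∏ i, 1 / ((m.1 i : ℕ) : ℝ) ^ k.get i = hsum k 0 M := by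
    intro M
    rw [hsum_eq_sum_chains, ← Finset.sum_preimage φ (chains k.length 0 M) hinj.injOn
      (fun l => invMonomial l k)]
    · exact Finset.sum_congr rfl fun m _ => (hval m).symm
    · intro l hl hl'
      exfalso
      apply hl'
      obtain ⟨h1, h2, h3⟩ := mem_chains.1 hl
      have hp : ∀ i : Fin k.length, 0 < l[i]'(by rw [h1]; exact i.2) :=
        fun i => (h3 _ (List.getElem_mem _)).1
      refine ⟨⟨fun i => ⟨(l[i]'(by rw [h1]; exact i.2)).toNat, by have := hp i; omega⟩, ?_⟩, ?_⟩
      · intro i j hij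
        have := List.pairwise_iff_getElem.1 h2 i j (by rw [h1]; exact i.2) (by rw [h1]; exact j.2) hij
        have h4 := hp i
        refine (PNat.coe_lt_coe (⟨_, _⟩ : ℕ+) ⟨_, _⟩).1 ?_
        exact (Int.toNat_lt_toNat (hp j)).2 this
      · apply List.ext_getElem
        · simp [hφ, h1]
        · intro i hi hi'
          simp only [hφ, List.getElem_ofFn, PNat.mk_coe]
          exact Int.toNat_of_nonneg (h3 _ (List.getElem_mem _)).1.le
  have hmono : Monotone s := by
    intro M N hMN m hm
    simp only [hs, Finset.mem_preimage, mem_chains] at hm ⊢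
    exact ⟨hm.1, hm.2.1, fun x hx => ⟨(hm.2.2 x hx).1,
      (hm.2.2 x hx).2.trans (by exact_mod_cast hMN)⟩⟩
  have hcover : ∀ m, ∃ M, m ∈ s M := by
    intro m
    refine ⟨∑ i, (m.1 i : ℕ), ?_⟩
    simp only [hs, Finset.mem_preimage, mem_chains, hφ]
    refine ⟨by simp, ?_, ?_⟩
    · rw [List.pairwise_ofFn]
      intro i j hij
      have := m.2 hij
      exact_mod_cast this
    · intro x hx
      rw [List.mem_ofFn] at hx
      obtain ⟨i, rfl⟩ := hx
      have : (m.1 i : ℕ) ≤ ∑ i, (m.1 i : ℕ) :=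
        Finset.single_le_sum (f := fun i => (m.1 i : ℕ)) (fun _ _ => Nat.zero_le _) (Finset.mem_univ i)
      exact ⟨by exact_mod_cast (m.1 i).pos, by exact_mod_cast this⟩
  have hs_tendsto := tendsto_atTop_finset_of_monotone hmono hcover
  have hnn : ∀ m : {f : Fin k.length → ℕ+ // StrictMono f},
      0 ≤ ∏ i, 1 / ((m.1 i : ℕ) : ℝ) ^ k.get i := fun m => by positivity
  have hsummable : Summable fun m : {f : Fin k.length → ℕ+ // StrictMono f} =>
      ∏ i, 1 / ((m.1 i : ℕ) : ℝ) ^ k.get i := by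
    refine summable_of_sum_le (c := C) hnn fun u => ?_
    obtain ⟨M, hM⟩ := (hs_tendsto.eventually (eventually_ge_atTop u)).exists
    exact (Finset.sum_le_sum_of_subset_of_nonneg hM fun m _ _ => hnn m).trans
      ((hsum_s M).le.trans (hC M))
  have := hsummable.hasSum.comp hs_tendsto
  simpa only [Function.comp_def, hsum_s, MZV] using this

lemma MZV_nil : MZV [] = 1 := by
  have := tendsto_hsum_MZV [] 1 (fun M => by simp [hsum])
  simp only [hsum] at this
  exact tendsto_nhds_unique this tendsto_const_nhds

lemma exists_eq_append_of_getLastD {k : List ℕ} (hk : 2 ≤ k.getLastD 2) (hne : k ≠ []) :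
    ∃ k' e, k = k' ++ [e] ∧ 2 ≤ e := by
  rcases List.eq_nil_or_concat' k with rfl | ⟨k', e, rfl⟩
  · exact absurd rfl hne
  · exact ⟨k', e, rfl, by simpa using hk⟩

lemma Admissible.sub_negligible {k : List ℕ} (hk : Admissible k) :
    (fun M : ℕ => MZV k - hsum k 0 M) ∈ negligible := by
  by_cases hne : k = []
  · subst hne
    have : (fun M : ℕ => MZV [] - hsum [] 0 M) = 0 := by
      ext M; simp [hsum, MZV_nil]
    rw [this]
    exact negligible.zero_mem
  obtain ⟨k', e, rfl, he⟩ := exists_eq_append_of_getLastD hk.2 hne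
  have hpos := hk.1
  simp only [List.mem_append] at hpos
  obtain ⟨C, hC0, hC⟩ := exists_hsum_le k' (fun i hi => hpos i (Or.inl hi)) e he
  have hbd : ∀ M : ℕ, hsum (k' ++ [e]) 0 M ≤ hsum (k' ++ [e]) 0 1 + C := by
    intro M
    rcases Nat.eq_zero_or_pos M with rfl | h
    · have := hsum_mono (k' ++ [e]) (Nat.zero_le 1)
      push_cast at this ⊢
      linarith
    · have := hC 1 M one_pos h
      have h2 : 0 ≤ C * (1 / √(M : ℝ)) := by positivity
      simp only [Nat.cast_one, Real.sqrt_one] at this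
      linarith
  have ht := tendsto_hsum_MZV _ _ hbd
  refine negligible_of_abs_le (2 * C) 0 fun M hM => ?_
  have hM1 : (1 : ℝ) ≤ M := by exact_mod_cast hM
  have h1 : hsum (k' ++ [e]) 0 M ≤ MZV (k' ++ [e]) :=
    ge_of_tendsto ht ((eventually_ge_atTop M).mono fun N hN => hsum_mono _ hN)
  have h2 : MZV (k' ++ [e]) ≤ hsum (k' ++ [e]) 0 M + C * (1 / √(M : ℝ)) := by
    refine le_of_tendsto ht ((eventually_ge_atTop M).mono fun N hN => ?_)
    have h3 := hC M N hM hN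
    have h4 : 0 ≤ C * (1 / √(N : ℝ)) := by positivity
    linarith
  rw [abs_of_nonneg (by linarith)]
  have h3 : √((M : ℝ) + 1) ≤ 2 * √(M : ℝ) := by
    rw [Real.sqrt_le_left (by positivity), mul_pow, Real.sq_sqrt (by positivity)]
    linarith
  have h4 : (0 : ℝ) < √((M : ℝ) + 1) := Real.sqrt_pos.2 (by positivity)
  have h5 : (0 : ℝ) < √(M : ℝ) := Real.sqrt_pos.2 (by positivity)
  have h6 : 1 / √(M : ℝ) ≤ 2 * (1 / √((M : ℝ) + 1)) := by
    rw [mul_one_div, div_le_div_iff₀ h5 h4]; linarith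
  calc _ ≤ C * (1 / √(M : ℝ)) := by linarith
    _ ≤ C * (2 * (1 / √((M : ℝ) + 1))) := mul_le_mul_of_nonneg_left h6 hC0
    _ = _ := by simp; ring

lemma Admissible.tendsto {k : List ℕ} (hk : Admissible k) :
    Tendsto (fun M : ℕ => hsum k 0 M) atTop (𝓝 (MZV k)) := by
  have := (hk.sub_negligible 0).const_sub (MZV k)
  simpa using this

lemma MZV_mul_MZV {u v : List ℕ} (hu : Admissible u) (hv : Admissible v) :
    MZV u * MZV v = ((stuffle u v).map MZV).sum := by
  have h1 := hu.tendsto.mul hv.tendsto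
  simp only [hsum_mul_hsum] at h1
  have h2 : ∀ S : Multiset (List ℕ), (∀ w ∈ S, Admissible w) →
      Tendsto (fun M : ℕ => (S.map (hsum · 0 (M : ℤ))).sum) atTop (𝓝 (S.map MZV).sum) := by
    intro S
    induction S using Multiset.induction with
    | empty => intro _; simp
    | cons w S ih =>
      intro h
      simp only [Multiset.map_cons, Multiset.sum_cons]
      exact (h w (by simp)).tendsto.add (ih fun x hx => h x (by simp [hx]))
  exact tendsto_nhds_unique h1 (h2 _ fun w hw => hu.of_mem_stuffle hw hv)

/-- The rational span of the products `π ^ (2 a) ζ(l)` with `l` admissible of depth at most `d`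
and total weight at most `w`. -/
noncomputable def mzvSpan (d w : ℕ) : Submodule ℚ ℝ :=
  Submodule.span ℚ {x : ℝ | ∃ (a : ℕ) (l : List ℕ),
      l.length ≤ d ∧ (∀ i ∈ l, 0 < i) ∧ 2 ≤ l.getLastD 2 ∧
      2 * a + l.sum ≤ w ∧ x = π ^ (2 * a) * MZV l}

lemma mzvSpan_mono {d d' w w' : ℕ} (hd : d ≤ d') (hw : w ≤ w') : mzvSpan d w ≤ mzvSpan d' w' := by
  refine Submodule.span_mono ?_
  rintro x ⟨a, l, h1, h2, h3, h4, rfl⟩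
  exact ⟨a, l, h1.trans hd, h2, h3, h4.trans hw, rfl⟩

lemma pi_pow_mul_mem_mzvSpan (a : ℕ) {l : List ℕ} (hl : Admissible l) :
    π ^ (2 * a) * MZV l ∈ mzvSpan l.length (2 * a + l.sum) :=
  Submodule.subset_span ⟨a, l, le_rfl, hl.1, hl.2, le_rfl, rfl⟩

lemma Admissible.mem_mzvSpan {l : List ℕ} (hl : Admissible l) : MZV l ∈ mzvSpan l.length l.sum := by
  simpa using pi_pow_mul_mem_mzvSpan 0 hl

lemma pi_pow_mem_mzvSpan (a : ℕ) : π ^ (2 * a) ∈ mzvSpan 0 (2 * a) := by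
  simpa [MZV_nil] using pi_pow_mul_mem_mzvSpan a (l := []) ⟨by simp, by simp⟩

lemma mul_mem_mzvSpan {d d' w w' : ℕ} {x y : ℝ} (hx : x ∈ mzvSpan d w) (hy : y ∈ mzvSpan d' w') :
    x * y ∈ mzvSpan (d + d') (w + w') := by
  have key : mzvSpan d w * mzvSpan d' w' ≤ mzvSpan (d + d') (w + w') := by
    rw [mzvSpan, mzvSpan, Submodule.span_mul_span, Submodule.span_le]
    rintro _ ⟨_, ⟨a, u, hu1, hu2, hu3, hu4, rfl⟩, _, ⟨b, v, hv1, hv2, hv3, hv4, rfl⟩, rfl⟩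
    have : π ^ (2 * a) * MZV u * (π ^ (2 * b) * MZV v) =
        ((stuffle u v).map fun l => π ^ (2 * (a + b)) * MZV l).sum := by
      rw [Multiset.sum_map_mul_left, ← MZV_mul_MZV ⟨hu2, hu3⟩ ⟨hv2, hv3⟩]
      ring
    simp only [this]
    refine multiset_sum_mem _ fun x hx => ?_
    obtain ⟨l, hl, rfl⟩ := Multiset.mem_map.1 hx
    have hl1 := length_pos_sum_of_mem_stuffle hl hu2 hv2
    have hl2 := Admissible.of_mem_stuffle hl ⟨hu2, hu3⟩ ⟨hv2, hv3⟩
    exact mzvSpan_mono (by omega) (by omega) (pi_pow_mul_mem_mzvSpan (a + b) hl2)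
  exact key (Submodule.mul_mem_mul hx hy)

/-- Sequences which, up to a negligible error, are polynomials in the harmonic numbers with
coefficients in `mzvSpan d w`. -/
noncomputable def asympSpan (d w : ℕ) : Submodule ℚ (ℕ → ℝ) where
  carrier := {f | ∃ P : Polynomial ℝ, (∀ j, P.coeff j ∈ mzvSpan d w) ∧
    (fun M => f M - P.eval (harm M)) ∈ negligible}
  add_mem' := by
    rintro f g ⟨P, hP, hf⟩ ⟨Q, hQ, hg⟩
    refine ⟨P + Q, fun j => ?_, ?_⟩
    · rw [Polynomial.coeff_add]; exact Submodule.add_mem _ (hP j) (hQ j)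
    · convert negligible.add_mem hf hg using 1
      ext M; simp; ring
  zero_mem' := by
    refine ⟨0, by simp, ?_⟩
    convert negligible.zero_mem using 1
    ext M; simp
  smul_mem' := by
    rintro c f ⟨P, hP, hf⟩
    refine ⟨c • P, fun j => ?_, ?_⟩
    · rw [Polynomial.coeff_smul]; exact Submodule.smul_mem _ _ (hP j)
    · convert negligible.smul_mem (c : ℝ) hf using 1
      ext M
      simp [Rat.smul_def, mul_sub]

lemma asympSpan_mono {d d' w w' : ℕ} (hd : d ≤ d') (hw : w ≤ w') :
    asympSpan d w ≤ asympSpan d' w' := by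
  rintro f ⟨P, hP, hf⟩
  exact ⟨P, fun j => mzvSpan_mono hd hw (hP j), hf⟩

lemma mem_asympSpan_of_negligible {f : ℕ → ℝ} (hf : f ∈ negligible) (d w : ℕ) :
    f ∈ asympSpan d w := ⟨0, by simp, by simpa using hf⟩

lemma mul_mem_asympSpan {d d' w w' : ℕ} {f g : ℕ → ℝ} (hf : f ∈ asympSpan d w)
    (hg : g ∈ asympSpan d' w') : f * g ∈ asympSpan (d + d') (w + w') := by
  obtain ⟨P, hP, hf⟩ := hf
  obtain ⟨Q, hQ, hg⟩ := hg
  refine ⟨P * Q, fun j => ?_, ?_⟩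
  · rw [Polynomial.coeff_mul]
    exact Submodule.sum_mem _ fun i _ => mul_mem_mzvSpan (hP _) (hQ _)
  · have h1 := negligible.mul hf hg
    have h2 := negligible.mul_eval hf Q
    have h3 := negligible.mul_eval hg P
    convert negligible.add_mem (negligible.add_mem h1 h2) h3 using 1
    ext M
    simp; ring

lemma harm_mem_asympSpan : harm ∈ asympSpan 0 0 := by
  have h1 : (1 : ℝ) ∈ mzvSpan 0 0 := by simpa using pi_pow_mem_mzvSpan 0
  refine ⟨Polynomial.X, fun j => ?_, ?_⟩
  · rw [Polynomial.coeff_X]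
    split_ifs
    · exact h1
    · exact Submodule.zero_mem _
  · convert negligible.zero_mem using 1
    ext M; simp

lemma const_mem_asympSpan {d w : ℕ} {x : ℝ} (hx : x ∈ mzvSpan d w) :
    (fun _ => x) ∈ asympSpan d w := by
  refine ⟨Polynomial.C x, fun j => ?_, ?_⟩
  · rw [Polynomial.coeff_C]
    split_ifs
    · exact hx
    · exact Submodule.zero_mem _
  · convert negligible.zero_mem using 1
    ext M; simp

/-- The sequence of truncated sums attached to a word. -/
noncomputable def hseq (k : List ℕ) (M : ℕ) : ℝ := hsum k 0 M

lemma Admissible.hseq_mem {k : List ℕ} (hk : Admissible k) :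
    hseq k ∈ asympSpan k.length k.sum := by
  have h1 := const_mem_asympSpan hk.mem_mzvSpan
  have h2 := mem_asympSpan_of_negligible hk.sub_negligible k.length k.sum
  convert Submodule.sub_mem _ h1 h2 using 1
  ext M; simp [hseq]

lemma Admissible.MZV_mem {k : List ℕ} (hk : Admissible k) {d w : ℕ} (h : hseq k ∈ asympSpan d w) :
    MZV k ∈ mzvSpan d w := by
  obtain ⟨P, hP, hf⟩ := h
  have h1 := negligible.add_mem hk.sub_negligible hf
  have h2 : P = Polynomial.C (MZV k) := by
    refine eq_C_of_negligible ?_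
    convert h1 using 1
    ext M; simp [hseq]
  have := hP 0
  rwa [h2, Polynomial.coeff_C_zero] at this

lemma hseq_mul_hseq (u v : List ℕ) : hseq u * hseq v = ((stuffle u v).map hseq).sum := by
  ext M
  have h : ∀ S : Multiset (List ℕ), (S.map hseq).sum M = (S.map (hsum · 0 (M : ℤ))).sum := by
    intro S
    induction S using Multiset.induction with
    | empty => simp
    | cons w S ih => simp [ih, hseq]
  rw [h, ← hsum_mul_hsum]; rfl

lemma stuffle_nil_left (v : List ℕ) : stuffle [] v = {v} := by simp [stuffle]

lemma two_le_getLastD_tail {x : ℕ} {t : List ℕ} (h : 2 ≤ (x :: t).getLastD 2) :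
    2 ≤ t.getLastD 2 := by
  cases t with
  | nil => simp
  | cons s t => rwa [getLastD_cons_self _ _ _ (by simp)] at h

lemma stuffle_one_append_replicate (v : List ℕ) (j : ℕ) (hv : 2 ≤ v.getLastD 2) :
    ∃ R : Multiset (List ℕ),
      stuffle [1] (v ++ List.replicate j 1) =
        (j + 1) • {v ++ List.replicate (j + 1) 1} + R ∧
      ∀ w ∈ R, ∃ v' j', w = v' ++ List.replicate j' 1 ∧ j' ≤ j ∧ v' ≠ [] ∧
        2 ≤ v'.getLastD 2 := by
  induction v with
  | nil =>
    induction j with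
    | zero => exact ⟨0, by simp [stuffle], by simp⟩
    | succ j ih =>
      obtain ⟨R, hR, hR'⟩ := ih
      refine ⟨R.map (1 :: ·) + {2 :: List.replicate j 1}, ?_, ?_⟩
      · rw [List.nil_append] at hR ⊢
        rw [List.replicate_succ, stuffle, hR, stuffle_nil_left, stuffle_nil_left]
        simp only [Multiset.map_add, Multiset.map_nsmul, Multiset.map_singleton, List.nil_append]
        rw [show List.replicate (j + 1 + 1) 1 = 1 :: 1 :: List.replicate j 1 by
          simp [List.replicate_succ], List.replicate_succ, succ_nsmul' _ (j + 1)]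
        simp only [add_assoc, Nat.reduceAdd]
      · intro w hw
        rw [Multiset.mem_add, Multiset.mem_map, Multiset.mem_singleton] at hw
        rcases hw with ⟨t, ht, rfl⟩ | rfl
        · obtain ⟨v', j', rfl, h1, h2, h3⟩ := hR' t ht
          exact ⟨1 :: v', j', by simp, by omega, by simp, by rwa [getLastD_cons_self _ _ _ h2]⟩
        · exact ⟨[2], j, by simp, by omega, by simp, by simp⟩
  | cons e v ih =>
    obtain ⟨R, hR, hR'⟩ := ih (two_le_getLastD_tail hv)
    refine ⟨{1 :: e :: (v ++ List.replicate j 1)} + R.map (e :: ·) +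
      {(1 + e) :: (v ++ List.replicate j 1)}, ?_, ?_⟩
    · rw [List.cons_append, stuffle, hR, stuffle_nil_left, stuffle_nil_left]
      simp only [Multiset.map_add, Multiset.map_nsmul, Multiset.map_singleton, List.cons_append]
      abel
    · intro w hw
      rw [Multiset.mem_add, Multiset.mem_add, Multiset.mem_map, Multiset.mem_singleton,
        Multiset.mem_singleton] at hw
      rcases hw with (rfl | ⟨t, ht, rfl⟩) | rfl
      · exact ⟨1 :: e :: v, j, by simp, le_rfl, by simp,
          by rwa [getLastD_cons_self _ _ _ (by simp)]⟩
      · obtain ⟨v', j', rfl, h1, h2, h3⟩ := hR' t ht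
        exact ⟨e :: v', j', by simp, h1, by simp, by rwa [getLastD_cons_self _ _ _ h2]⟩
      · refine ⟨(1 + e) :: v, j, by simp, le_rfl, by simp, ?_⟩
        by_cases h : v = []
        · subst h; simp at hv ⊢; omega
        · rwa [getLastD_cons_self _ _ _ h, ← getLastD_cons_self e _ _ h]

lemma hseq_one : hseq [1] = harm := rfl

lemma hseq_append_replicate_mem {S : Submodule ℚ (ℕ → ℝ)} {v : List ℕ} {j : ℕ}
    (hv : 2 ≤ v.getLastD 2) (h : harm * hseq (v ++ List.replicate j 1) ∈ S)
    (hS : ∀ v' j', v' ++ List.replicate j' 1 ∈ stuffle [1] (v ++ List.replicate j 1) → j' ≤ j →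
      v' ≠ [] → 2 ≤ v'.getLastD 2 → hseq (v' ++ List.replicate j' 1) ∈ S) :
    hseq (v ++ List.replicate (j + 1) 1) ∈ S := by
  obtain ⟨R, hR, hR'⟩ := stuffle_one_append_replicate v j hv
  rw [← hseq_one, hseq_mul_hseq, hR, Multiset.map_add, Multiset.sum_add, Multiset.map_nsmul,
    Multiset.sum_nsmul, Multiset.map_singleton, Multiset.sum_singleton] at h
  have hRS : (R.map hseq).sum ∈ S := by
    refine multiset_sum_mem _ fun x hx => ?_
    obtain ⟨w, hw, rfl⟩ := Multiset.mem_map.1 hx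
    obtain ⟨v', j', rfl, h1, h2, h3⟩ := hR' w hw
    exact hS v' j' (by rw [hR]; simp [hw]) h1 h2 h3
  have h1 := (Submodule.add_mem_iff_left S hRS).1 h
  have h2 := S.smul_mem ((j + 1 : ℕ) : ℚ)⁻¹ h1
  rwa [← Nat.cast_smul_eq_nsmul ℚ, smul_smul, inv_mul_cancel₀ (by positivity), one_smul] at h2

lemma exists_eq_append_replicate (k : List ℕ) (hk : ∀ i ∈ k, 0 < i) :
    ∃ v j, k = v ++ List.replicate j 1 ∧ 2 ≤ v.getLastD 2 := by
  induction k using List.reverseRecOn with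
  | nil => exact ⟨[], 0, by simp, by simp⟩
  | append_singleton k e ih =>
    by_cases he : e = 1
    · obtain ⟨v, j, rfl, h⟩ := ih fun i hi => hk i (by simp [hi])
      exact ⟨v, j + 1, by rw [he, List.replicate_succ']; simp, h⟩
    · have := hk e (by simp)
      exact ⟨k ++ [e], 0, by simp, by simp; omega⟩

lemma hseq_mem (k : List ℕ) (hk : ∀ i ∈ k, 0 < i) : hseq k ∈ asympSpan k.length k.sum := by
  obtain ⟨v, j, rfl, hv⟩ := exists_eq_append_replicate k hk
  induction j using Nat.strong_induction_on generalizing v with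
  | _ j ih =>
    cases j with
    | zero =>
      rw [List.replicate_zero, List.append_nil] at hk ⊢
      exact Admissible.hseq_mem ⟨hk, hv⟩
    | succ j =>
      have hk' : ∀ i ∈ v ++ List.replicate j 1, 0 < i := fun i hi => by
        simp only [List.mem_append, List.mem_replicate] at hi hk
        refine hk i (hi.imp_right fun h => ⟨by omega, h.2⟩)
      refine hseq_append_replicate_mem hv ?_ ?_
      · have := mul_mem_asympSpan harm_mem_asympSpan (ih j (by omega) v hv hk')
        exact asympSpan_mono (by simp) (by simp) this
      · intro v' j' hw hj' hne hv'
        have h1 := length_pos_sum_of_mem_stuffle hw (by simp) hk'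
        have h2 := ih j' (by omega) v' hv' h1.2.1
        refine asympSpan_mono (h1.1.trans ?_) (h1.2.2.le.trans ?_) h2
        · simp; omega
        · simp; omega

/-- Words whose weight and depth have different parities. -/
def Mismatched (k : List ℕ) : Prop := k.sum % 2 ≠ k.length % 2

/-- The sequence of a word is of lower depth. -/
def IsLower (k : List ℕ) : Prop := hseq k ∈ asympSpan (k.length - 1) k.sum

lemma isLower_of_admissible (n : ℕ)
    (h : ∀ k, Admissible k → k.length = n → Mismatched k → IsLower k) (k : List ℕ)
    (hk : ∀ i ∈ k, 0 < i) (hn : k.length = n) (hm : Mismatched k) : IsLower k := by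
  obtain ⟨v, j, rfl, hv⟩ := exists_eq_append_replicate k hk
  induction j using Nat.strong_induction_on generalizing v with
  | _ j ih =>
    cases j with
    | zero =>
      rw [List.replicate_zero, List.append_nil] at hk hn hm ⊢
      exact h v ⟨hk, hv⟩ hn hm
    | succ j =>
      have hk' : ∀ i ∈ v ++ List.replicate j 1, 0 < i := fun i hi => by
        simp only [List.mem_append, List.mem_replicate] at hi hk
        refine hk i (hi.imp_right fun h => ⟨by omega, h.2⟩)
      have hlen : (v ++ List.replicate (j + 1) 1).length = (v ++ List.replicate j 1).length + 1 := by
        simp; omega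
      have hsum : (v ++ List.replicate (j + 1) 1).sum = (v ++ List.replicate j 1).sum + 1 := by
        simp; omega
      refine hseq_append_replicate_mem hv ?_ ?_
      · have := mul_mem_asympSpan harm_mem_asympSpan (hseq_mem _ hk')
        exact asympSpan_mono (by rw [hlen]; omega) (by rw [hsum]; omega) this
      · intro v' j' hw hj' hne hv'
        have h1 := length_pos_sum_of_mem_stuffle hw (by simp) hk'
        have h2 : ([1] : List ℕ).length = 1 := rfl
        have h3 : ([1] : List ℕ).sum = 1 := rfl
        by_cases hl : (v' ++ List.replicate j' 1).length = n
        · have h4 : Mismatched (v' ++ List.replicate j' 1) := by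
            unfold Mismatched at hm ⊢
            rw [hl, h1.2.2, h3, add_comm, ← hsum, ← hn]
            exact hm
          have h5 := ih j' (by omega) v' hv' h1.2.1 hl h4
          exact asympSpan_mono (by omega) (by omega) h5
        · exact asympSpan_mono (by omega) (by omega) (hseq_mem _ h1.2.1)

/-- The sequence of truncated sums over down-pointing peaks. -/
noncomputable def vseq (u : List ℕ) (e : ℕ) (v : List ℕ) (M : ℕ) : ℝ := vsum u e v 0 M

lemma vseq_eq (u : List ℕ) (e : ℕ) (v : List ℕ) :
    vseq u e v = ((stuffle u v).map (fun w => hseq (e :: w))).sum := by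
  ext M
  have h : ∀ S : Multiset (List ℕ), (S.map (fun w => hseq (e :: w))).sum M =
      (S.map (fun w => hsum (e :: w) 0 (M : ℤ))).sum := by
    intro S
    induction S using Multiset.induction with
    | empty => simp
    | cons w S ih => simp [ih, hseq]
  rw [h, ← vsum_eq]; rfl

lemma vseq_nil_left (e : ℕ) (v : List ℕ) : vseq [] e v = hseq (e :: v) := by
  simp [vseq_eq, stuffle]

lemma vseq_nil_right (u : List ℕ) (e : ℕ) : vseq u e [] = hseq (e :: u) := by
  have : stuffle u [] = {u} := by cases u <;> simp [stuffle]
  simp [vseq_eq, this]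

lemma vseq_mem {u v : List ℕ} {e : ℕ} (hu : ∀ i ∈ u, 0 < i) (he : 0 < e) (hv : ∀ i ∈ v, 0 < i) :
    vseq u e v ∈ asympSpan (u.length + v.length + 1) (u.sum + v.sum + e) := by
  rw [vseq_eq]
  refine multiset_sum_mem _ fun x hx => ?_
  obtain ⟨w, hw, rfl⟩ := Multiset.mem_map.1 hx
  have h1 := length_pos_sum_of_mem_stuffle hw hu hv
  have h2 := hseq_mem (e :: w) (by simpa [he] using h1.2.1)
  simp only [List.length_cons, List.sum_cons] at h2
  exact asympSpan_mono (by omega) (by omega) h2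

lemma hseq_cons_mul_hseq_cons (x : ℕ) (u : List ℕ) (y : ℕ) (v : List ℕ) :
    hseq (x :: u) * hseq (y :: v) = vseq u x (y :: v) + vseq (x :: u) y v + vseq u (x + y) v := by
  ext M
  exact hsum_cons_mul_hsum_cons x u y v 0 M

/-- A product of two words of positive depth is of lower depth as soon as total weight and total
depth have different parities. -/
lemma hseq_mul_hseq_mem {d : ℕ}
    (hd : ∀ k : List ℕ, (∀ i ∈ k, 0 < i) → k.length < d → Mismatched k → IsLower k)
    {u v : List ℕ} (hu : ∀ i ∈ u, 0 < i) (hv : ∀ i ∈ v, 0 < i) (hu0 : u ≠ []) (hv0 : v ≠ [])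
    (hl : u.length + v.length = d) (hm : (u.sum + v.sum) % 2 ≠ d % 2) :
    hseq u * hseq v ∈ asympSpan (d - 1) (u.sum + v.sum) := by
  have h1 := List.length_pos_iff.2 hu0
  have h2 := List.length_pos_iff.2 hv0
  by_cases h : Mismatched u
  · have := mul_mem_asympSpan (hd u hu (by omega) h) (hseq_mem v hv)
    exact asympSpan_mono (by omega) le_rfl this
  · have h' : Mismatched v := by
      unfold Mismatched at h ⊢; omega
    have := mul_mem_asympSpan (hseq_mem u hu) (hd v hv (by omega) h')
    exact asympSpan_mono (by omega) le_rfl this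

lemma vseq_sub_mem {d w : ℕ}
    (hd : ∀ k : List ℕ, (∀ i ∈ k, 0 < i) → k.length < d → Mismatched k → IsLower k)
    (hm : w % 2 ≠ d % 2) (u : List ℕ) (a : ℕ) (v : List ℕ) (hu : ∀ i ∈ u, 0 < i) (ha : 0 < a)
    (hv : ∀ i ∈ v, 0 < i) (hl : u.length + v.length + 1 = d) (hw : u.sum + v.sum + a = w) :
    vseq u a v - (-1 : ℚ) ^ v.length • hseq (v.reverse ++ a :: u) ∈ asympSpan (d - 1) w := by
  induction v generalizing u a with
  | nil => simp [vseq_nil_right]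
  | cons b v ih =>
    simp only [List.mem_cons, forall_eq_or_imp, List.length_cons, List.sum_cons] at hv hl hw
    have h1 := ih (a :: u) b (by simpa [ha] using hu) hv.1 hv.2
      (by simp only [List.length_cons]; omega) (by simp only [List.sum_cons]; omega)
    have h2 := hseq_mul_hseq_mem hd (u := a :: u) (v := b :: v) (by simpa [ha] using hu)
      (by simpa [hv.1] using hv.2) (by simp) (by simp)
      (by simp only [List.length_cons]; omega) (by simp only [List.sum_cons]; convert hm using 2; omega)
    have h3 := vseq_mem hu (e := a + b) (by omega) hv.2
    rw [hseq_cons_mul_hseq_cons] at h2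
    have h2' := asympSpan_mono le_rfl (show _ ≤ w by simp only [List.sum_cons]; omega) h2
    have h3' := asympSpan_mono (show _ ≤ d - 1 by omega) (show _ ≤ w by omega) h3
    convert Submodule.sub_mem _ (Submodule.sub_mem _ h2' h3') h1 using 1
    simp only [List.reverse_cons, List.append_assoc, List.singleton_append, List.length_cons,
      pow_succ]
    module

/-- The consequence of the antipode relation modulo lower depth. -/
lemma hseq_add_reverse_mem {k : List ℕ} (hk : ∀ i ∈ k, 0 < i) (hne : k ≠ []) (hm : Mismatched k)
    (hd : ∀ l : List ℕ, (∀ i ∈ l, 0 < i) → l.length < k.length → Mismatched l → IsLower l) :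
    hseq k + (-1 : ℚ) ^ k.length • hseq k.reverse ∈ asympSpan (k.length - 1) k.sum := by
  cases k with
  | nil => exact absurd rfl hne
  | cons a v =>
    simp only [List.mem_cons, forall_eq_or_imp] at hk
    have := vseq_sub_mem hd hm [] a v (by simp) hk.1 hk.2 (by simp) (by simp; omega)
    rw [vseq_nil_left] at this
    convert this using 1
    simp only [List.length_cons, List.reverse_cons, pow_succ]
    module

/-- The regularized sums `∑_{c ≠ 0} c⁻ˢ` over the integers, with value `-1` at `s = 0`. -/
noncomputable def beta (s : ℕ) : ℝ := if s = 0 then -1 else if Even s then 2 * MZV [s] else 0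

lemma beta_zero : beta 0 = -1 := by simp [beta]

lemma MZV_singleton_mem {s : ℕ} (hs : Even s) (h0 : s ≠ 0) : MZV [s] ∈ mzvSpan 0 s := by
  obtain ⟨t, rfl⟩ := hs
  rw [← two_mul] at h0 ⊢
  have ht : t ≠ 0 := by omega
  have h1 := (hasSum_zeta_nat ht).tendsto_sum_nat.comp (tendsto_add_atTop_nat 1)
  have h2 : Tendsto (fun M : ℕ => hsum [2 * t] 0 M) atTop (𝓝 (MZV [2 * t])) :=
    Admissible.tendsto ⟨by simp; omega, by simp; omega⟩
  have h3 : (fun M : ℕ => hsum [2 * t] 0 M) =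
      (fun n : ℕ => ∑ i ∈ Finset.range n, 1 / (i : ℝ) ^ (2 * t)) ∘ fun a => a + 1 := by
    ext M
    simp only [Function.comp, hsum, mul_one]
    induction M with
    | zero => simp [ht]
    | succ M ih =>
      rw [sum_Ioc_succ, ih, Finset.sum_range_succ _ (M + 1)]
      push_cast
      rw [inv_pow, one_div]
  rw [h3] at h2
  rw [tendsto_nhds_unique h2 h1]
  convert Submodule.smul_mem _ ((-1 : ℚ) ^ (t + 1) * (2 : ℚ) ^ (2 * t - 1) * bernoulli (2 * t) /
    (2 * t).factorial) (pi_pow_mem_mzvSpan t) using 1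
  rw [Rat.smul_def]
  push_cast
  ring

lemma beta_mem (s : ℕ) : beta s ∈ mzvSpan 0 s := by
  unfold beta
  split_ifs with h0 h
  · subst h0
    have := Submodule.smul_mem _ (-1 : ℚ) (pi_pow_mem_mzvSpan 0)
    simpa using this
  · have := Submodule.smul_mem _ (2 : ℚ) (MZV_singleton_mem h h0)
    simpa [Rat.smul_def] using this
  · exact Submodule.zero_mem _

lemma sum_Icc_neg_succ (f : ℤ → ℝ) (N : ℕ) :
    ∑ c ∈ Finset.Icc (-((N + 1 : ℕ) : ℤ)) ((N + 1 : ℕ) : ℤ), f c =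
      ∑ c ∈ Finset.Icc (-(N : ℤ)) N, f c + (f (N + 1) + f (-(N + 1))) := by
  have : Finset.Icc (-((N + 1 : ℕ) : ℤ)) ((N + 1 : ℕ) : ℤ) =
      insert ((N : ℤ) + 1) (insert (-((N : ℤ) + 1)) (Finset.Icc (-(N : ℤ)) N)) := by
    ext x; simp only [Finset.mem_Icc, Finset.mem_insert]; push_cast; omega
  rw [this, Finset.sum_insert, Finset.sum_insert]
  · ring
  · simp
  · simp only [Finset.mem_insert, Finset.mem_Icc]; omega

lemma sum_symm_inv_pow {e : ℕ} (he : e ≠ 0) (N : ℕ) :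
    ∑ c ∈ Finset.Icc (-(N : ℤ)) N, ((c : ℝ)⁻¹) ^ e = (1 + (-1) ^ e) * hsum [e] 0 N := by
  simp only [hsum, mul_one]
  induction N with
  | zero => simp [he]
  | succ N ih =>
    rw [sum_Icc_neg_succ, ih, sum_Ioc_succ]
    have : (((-((N : ℤ) + 1) : ℤ) : ℝ)⁻¹) ^ e = (-1) ^ e * ((((N : ℤ) + 1 : ℤ) : ℝ)⁻¹) ^ e := by
      rw [← mul_pow]; push_cast; rw [inv_neg]; ring
    rw [this]; ring

lemma tendsto_sum_symm_inv_pow {e : ℕ} (he : e ≠ 0) :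
    Tendsto (fun N : ℕ => ∑ c ∈ Finset.Icc (-(N : ℤ)) N, ((c : ℝ)⁻¹) ^ e) atTop (𝓝 (beta e)) := by
  simp only [sum_symm_inv_pow he, beta, if_neg he]
  split_ifs with h
  · have h2 : 2 ≤ e := by
      obtain ⟨t, rfl⟩ := h; omega
    have : Tendsto (fun M : ℕ => hsum [e] 0 M) atTop (𝓝 (MZV [e])) :=
      Admissible.tendsto ⟨by simp; omega, by simpa using h2⟩
    rw [h.neg_one_pow]
    convert this.const_mul 2 using 2
    norm_num
  · rw [(Nat.not_even_iff_odd.1 h).neg_one_pow]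
    simp

lemma tendsto_inv_add_pow {e : ℕ} (he : e ≠ 0) (a : ℤ) :
    Tendsto (fun N : ℕ => ((((N : ℤ) + a : ℤ) : ℝ)⁻¹) ^ e) atTop (𝓝 0) := by
  have h1 : Tendsto (fun N : ℕ => (((N : ℤ) + a : ℤ) : ℝ)) atTop atTop := by
    push_cast
    exact tendsto_atTop_add_const_right _ _ tendsto_natCast_atTop_atTop
  have := (h1.inv_tendsto_atTop).pow e
  simpa [he] using this

lemma tendsto_inv_neg_add_pow {e : ℕ} (he : e ≠ 0) (a : ℤ) :
    Tendsto (fun N : ℕ => (((-(N : ℤ) + a : ℤ) : ℝ)⁻¹) ^ e) atTop (𝓝 0) := by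
  have := (tendsto_inv_add_pow he (-a)).const_mul ((-1) ^ e)
  rw [mul_zero] at this
  refine this.congr fun N => ?_
  rw [← mul_pow, neg_one_mul, ← inv_neg]
  push_cast
  ring_nf

lemma sum_Icc_shift_one (g : ℤ → ℝ) (N : ℕ) :
    ∑ c ∈ Finset.Icc (-(N : ℤ)) N, g (c + 1) =
      ∑ c ∈ Finset.Icc (-(N : ℤ)) N, g c + (g (N + 1) - g (-N)) := by
  induction N with
  | zero => simp
  | succ N ih =>
    rw [sum_Icc_neg_succ, sum_Icc_neg_succ, ih]
    push_cast
    rw [show -((N : ℤ) + 1) + 1 = -N by ring]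
    ring

lemma tendsto_sum_shift_inv_pow {e : ℕ} (he : e ≠ 0) (a : ℤ) :
    Tendsto (fun N : ℕ => ∑ c ∈ Finset.Icc (-(N : ℤ)) N, (((c + a : ℤ) : ℝ)⁻¹) ^ e) atTop
      (𝓝 (beta e)) := by
  have key : ∀ a : ℤ, Tendsto (fun N : ℕ =>
      ∑ c ∈ Finset.Icc (-(N : ℤ)) N, (((c + (a + 1) : ℤ) : ℝ)⁻¹) ^ e -
      ∑ c ∈ Finset.Icc (-(N : ℤ)) N, (((c + a : ℤ) : ℝ)⁻¹) ^ e) atTop (𝓝 0) := by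
    intro a
    have := (tendsto_inv_add_pow he (a + 1)).sub (tendsto_inv_neg_add_pow he a)
    rw [sub_zero] at this
    refine this.congr fun N => ?_
    have h := sum_Icc_shift_one (fun c => (((c + a : ℤ) : ℝ)⁻¹) ^ e) N
    simp only [add_assoc, add_comm (1 : ℤ) a] at h
    rw [h]; ring
  induction a using Int.induction_on with
  | zero => simpa using tendsto_sum_symm_inv_pow he
  | succ a ih => simpa using ih.add (key a)
  | pred a ih =>
    have := ih.sub (key (-(a : ℤ) - 1))
    simpa using this

/-- The generating series of `beta`. -/
noncomputable def betaSeries : PowerSeries ℝ := PowerSeries.mk beta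

/-- The power series `(x + X)⁻¹`. -/
noncomputable def invLin (x : ℝ) : PowerSeries ℝ := (PowerSeries.C x + PowerSeries.X)⁻¹

lemma invLin_mul {x : ℝ} (hx : x ≠ 0) : invLin x * (PowerSeries.C x + PowerSeries.X) = 1 :=
  PowerSeries.inv_mul_cancel _ (by simpa using hx)

lemma constantCoeff_invLin (x : ℝ) : PowerSeries.constantCoeff (invLin x) = x⁻¹ := by
  simp [invLin, PowerSeries.constantCoeff_inv]

lemma invLin_sub {x y : ℝ} (hx : x ≠ 0) (hy : y ≠ 0) :
    invLin x - invLin y = PowerSeries.C (y - x) * (invLin x * invLin y) := by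
  have h1 := invLin_mul hx
  have h2 := invLin_mul hy
  rw [map_sub]
  linear_combination (-invLin x) * h2 + invLin y * h1

/-- The value of the regularized sum over all integer translates of a finite set. -/
noncomputable def transVal (A : Finset ℤ) (e : ℤ → ℕ) : ℝ :=
  ∑ i ∈ A, PowerSeries.coeff (e i) (betaSeries * ∏ n ∈ A.erase i, invLin (((n - i : ℤ)) : ℝ) ^ e n)

/-- The partial sums over integer translates of a finite set. -/
noncomputable def transSum (A : Finset ℤ) (e : ℤ → ℕ) (N : ℕ) : ℝ :=
  ∑ c ∈ Finset.Icc (-(N : ℤ)) N with ∀ n ∈ A, c + n ≠ 0, ∏ n ∈ A, (((c + n : ℤ) : ℝ)⁻¹) ^ e n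

lemma prod_pow_add_single {R : Type*} [CommMonoid R] (A : Finset ℤ) (g : ℤ → R) (e : ℤ → ℕ) (a : ℤ) :
    ∏ n ∈ A, g n ^ (e + Pi.single a 1 : ℤ → ℕ) n = (∏ n ∈ A, g n ^ e n) * if a ∈ A then g a else 1 := by
  simp only [Pi.add_apply, pow_add, Finset.prod_mul_distrib]
  congr 1
  rw [← Finset.prod_pow_boole]
  refine Finset.prod_congr rfl fun n _ => ?_
  simp [Pi.single_apply, eq_comm]

lemma transSum_sub {A : Finset ℤ} {a b : ℤ} (ha : a ∈ A) (hb : b ∈ A) (f : ℤ → ℕ) (N : ℕ) :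
    ((b - a : ℤ) : ℝ) * transSum A (f + Pi.single a 1 + Pi.single b 1) N =
      transSum A (f + Pi.single a 1) N - transSum A (f + Pi.single b 1) N := by
  unfold transSum
  rw [Finset.mul_sum, ← Finset.sum_sub_distrib]
  refine Finset.sum_congr rfl fun c hc => ?_
  have h := (Finset.mem_filter.1 hc).2
  have h1 : ((c + a : ℤ) : ℝ) ≠ 0 := by exact_mod_cast h a ha
  have h2 : ((c + b : ℤ) : ℝ) ≠ 0 := by exact_mod_cast h b hb
  simp only [prod_pow_add_single A (fun n => (((c + n : ℤ) : ℝ)⁻¹)), if_pos ha, if_pos hb]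
  have : (((b - a : ℤ) : ℝ)) * ((((c + a : ℤ) : ℝ)⁻¹) * (((c + b : ℤ) : ℝ)⁻¹)) =
      (((c + a : ℤ) : ℝ)⁻¹) - (((c + b : ℤ) : ℝ)⁻¹) := by
    rw [inv_sub_inv h1 h2]
    push_cast
    field_simp
    ring
  linear_combination (∏ n ∈ A, (((c + n : ℤ) : ℝ)⁻¹) ^ f n) * this

lemma coeff_succ_eq (G : PowerSeries ℝ) {x : ℝ} (hx : x ≠ 0) (m : ℕ) :
    PowerSeries.coeff (m + 1) G = x * PowerSeries.coeff (m + 1) (G * invLin x) +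
      PowerSeries.coeff m (G * invLin x) := by
  have : G = PowerSeries.C x * (G * invLin x) + G * invLin x * PowerSeries.X := by
    linear_combination (-G) * invLin_mul hx
  conv_lhs => rw [this]
  rw [map_add, PowerSeries.coeff_C_mul, PowerSeries.coeff_succ_mul_X]

lemma transVal_sub {A : Finset ℤ} {a b : ℤ} (ha : a ∈ A) (hb : b ∈ A) (hab : a ≠ b) (f : ℤ → ℕ) :
    ((b - a : ℤ) : ℝ) * transVal A (f + Pi.single a 1 + Pi.single b 1) =
      transVal A (f + Pi.single a 1) - transVal A (f + Pi.single b 1) := by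
  unfold transVal
  rw [Finset.mul_sum, ← Finset.sum_sub_distrib]
  refine Finset.sum_congr rfl fun i hi => ?_
  simp only [prod_pow_add_single (A.erase i) (fun n => invLin (((n - i : ℤ)) : ℝ)),
    Finset.mem_erase, ha, hb, and_true, ← mul_assoc]
  set G := betaSeries * ∏ n ∈ A.erase i, invLin (((n - i : ℤ)) : ℝ) ^ f n
  have hba : ((b - a : ℤ) : ℝ) ≠ 0 := by exact_mod_cast sub_ne_zero.2 hab.symm
  have hab' : ((a - b : ℤ) : ℝ) ≠ 0 := by exact_mod_cast sub_ne_zero.2 hab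
  by_cases hia : i = a
  · subst hia
    have h := coeff_succ_eq G hba (f i)
    simp [hab.symm, hab] at h ⊢
    linarith
  by_cases hib : i = b
  · subst hib
    have h := coeff_succ_eq G hab' (f i)
    simp [hab.symm, hab] at h ⊢
    linarith
  have h1 : ((a - i : ℤ) : ℝ) ≠ 0 := by exact_mod_cast sub_ne_zero.2 (Ne.symm hia)
  have h2 : ((b - i : ℤ) : ℝ) ≠ 0 := by exact_mod_cast sub_ne_zero.2 (Ne.symm hib)
  rw [if_pos (Ne.symm hia), if_pos (Ne.symm hib)]
  simp only [Pi.add_apply, Pi.single_eq_of_ne hia, Pi.single_eq_of_ne hib, add_zero]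
  rw [← map_sub, ← mul_sub, invLin_sub h1 h2, ← PowerSeries.coeff_C_mul]
  congr 1
  push_cast
  rw [show (b : ℝ) - i - (a - i) = b - a by ring]
  ring

lemma tendsto_transSum_single {A : Finset ℤ} {a : ℤ} (ha : a ∈ A) {e : ℤ → ℕ} (he : e a ≠ 0)
    (h0 : ∀ n ∈ A, n ≠ a → e n = 0) :
    Tendsto (transSum A e) atTop (𝓝 (transVal A e)) := by
  have h1 : transVal A e = beta (e a) - ∑ n ∈ A, (((a - n : ℤ) : ℝ)⁻¹) ^ e a := by
    rw [transVal, ← Finset.add_sum_erase A _ ha, ← Finset.add_sum_erase A (fun n =>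
      (((a - n : ℤ) : ℝ)⁻¹) ^ e a) ha]
    have h2 : ∏ n ∈ A.erase a, invLin ((n - a : ℤ) : ℝ) ^ e n = 1 :=
      Finset.prod_eq_one fun n hn => by
        rw [h0 n (Finset.mem_of_mem_erase hn) (Finset.ne_of_mem_erase hn), pow_zero]
    rw [h2]
    simp only [mul_one, betaSeries, PowerSeries.coeff_mk, sub_self, Int.cast_zero, inv_zero,
      zero_pow he, zero_add, sub_eq_add_neg, ← Finset.sum_neg_distrib]
    congr 1
    refine Finset.sum_congr rfl fun i hi => ?_
    have hia := Finset.ne_of_mem_erase hi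
    rw [h0 i (Finset.mem_of_mem_erase hi) hia, PowerSeries.coeff_zero_eq_constantCoeff_apply,
      map_mul, ← PowerSeries.coeff_zero_eq_constantCoeff_apply, PowerSeries.coeff_mk, beta_zero,
      ← Finset.mul_prod_erase (A.erase i) _ (Finset.mem_erase.2 ⟨Ne.symm hia, ha⟩),
      Finset.prod_eq_one (s := (A.erase i).erase a), mul_one, map_pow, constantCoeff_invLin]
    · simp
    · intro n hn
      simp only [Finset.mem_erase] at hn
      rw [h0 n hn.2.2 hn.1, pow_zero]
  rw [h1]
  have h3 := (tendsto_sum_shift_inv_pow he a).sub_const (∑ n ∈ A, (((a - n : ℤ) : ℝ)⁻¹) ^ e a)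
  refine h3.congr' ?_
  filter_upwards [eventually_ge_atTop (∑ n ∈ A, n.natAbs)] with N hN
  have hN' : ∀ n ∈ A, n.natAbs ≤ N := fun n hn =>
    (Finset.single_le_sum (f := fun n : ℤ => n.natAbs) (fun _ _ => Nat.zero_le _) hn).trans hN
  have h4 : transSum A e N = ∑ c ∈ Finset.Icc (-(N : ℤ)) N with ∀ n ∈ A, c + n ≠ 0,
      (((c + a : ℤ) : ℝ)⁻¹) ^ e a := by
    refine Finset.sum_congr rfl fun c _ => ?_
    exact Finset.prod_eq_single_of_mem a ha fun n hn hna => by rw [h0 n hn hna, pow_zero]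
  rw [h4, ← Finset.sum_filter_add_sum_filter_not (Finset.Icc (-(N : ℤ)) N)
    (fun c => ∀ n ∈ A, c + n ≠ 0)]
  have h5 : (Finset.Icc (-(N : ℤ)) N).filter (fun c => ¬ ∀ n ∈ A, c + n ≠ 0) =
      A.image fun n => -n := by
    ext c
    simp only [Finset.mem_filter, Finset.mem_Icc, Finset.mem_image, not_forall, not_not]
    constructor
    · rintro ⟨-, n, hn, h⟩
      exact ⟨n, hn, by omega⟩
    · rintro ⟨n, hn, rfl⟩
      have := hN' n hn
      exact ⟨by omega, n, hn, by omega⟩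
  rw [h5, Finset.sum_image (by intro x _ y _ h; simpa using h)]
  simp only [neg_add_eq_sub]
  ring

/-- The symmetric sum over integer translates, as a residue computation. -/
lemma tendsto_transSum {A : Finset ℤ} {e : ℤ → ℕ} (h : ∃ a ∈ A, e a ≠ 0) :
    Tendsto (transSum A e) atTop (𝓝 (transVal A e)) := by
  obtain ⟨n, hn⟩ : ∃ n, ∑ a ∈ A, e a = n := ⟨_, rfl⟩
  induction n generalizing e with
  | zero =>
    obtain ⟨a, ha, ha'⟩ := h
    exact absurd ((Finset.sum_eq_zero_iff.1 hn) a ha) ha'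
  | succ n ih =>
    obtain ⟨a, ha, hea⟩ := h
    by_cases h' : ∃ b ∈ A, b ≠ a ∧ e b ≠ 0
    · obtain ⟨b, hb, hba, heb⟩ := h'
      obtain ⟨f, rfl⟩ : ∃ f : ℤ → ℕ, e = f + Pi.single a 1 + Pi.single b 1 := by
        refine ⟨e - Pi.single a 1 - Pi.single b 1, ?_⟩
        ext x
        simp only [Pi.add_apply, Pi.sub_apply, Pi.single_apply]
        split_ifs <;> subst_vars <;> omega
      have hsum : ∀ (g : ℤ → ℕ) (x : ℤ), x ∈ A →
          ∑ y ∈ A, (g + Pi.single x 1 : ℤ → ℕ) y = ∑ y ∈ A, g y + 1 := by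
        intro g x hx
        simp [Finset.sum_add_distrib, Finset.sum_pi_single', hx]
      have h1 : ∑ x ∈ A, f x + 1 = n := by
        rw [hsum _ _ hb, hsum _ _ ha] at hn; omega
      have h2 := ih (e := f + Pi.single a 1) ⟨a, ha, by simp⟩ (by rw [hsum _ _ ha, h1])
      have h3 := ih (e := f + Pi.single b 1) ⟨b, hb, by simp⟩ (by rw [hsum _ _ hb, h1])
      have hba' : ((b - a : ℤ) : ℝ) ≠ 0 := by exact_mod_cast sub_ne_zero.2 hba
      have h4 := (h2.sub h3).const_mul (((b - a : ℤ) : ℝ)⁻¹)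
      rw [← transVal_sub ha hb hba.symm, inv_mul_cancel_left₀ hba'] at h4
      refine h4.congr fun N => ?_
      rw [← transSum_sub ha hb, inv_mul_cancel_left₀ hba']
    · push Not at h'
      exact tendsto_transSum_single ha hea fun n hn hna => h' n hn hna

/-- The product `∏ g (l_i) ^ k_i`. -/
def zpow {R : Type*} [CommMonoid R] (g : ℤ → R) (l : List ℤ) (k : List ℕ) : R :=
  (List.zipWith (fun n e => g n ^ e) l k).prod

lemma zpow_inv (l : List ℤ) (k : List ℕ) : zpow (fun x => (x : ℝ)⁻¹) l k = invMonomial l k := rfl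

lemma zpow_map {R : Type*} [CommMonoid R] (g : ℤ → R) (f : ℤ → ℤ) (l : List ℤ) (k : List ℕ) :
    zpow g (l.map f) k = zpow (fun n => g (f n)) l k := by
  simp [zpow, List.zipWith_map_left]

lemma zpow_cons {R : Type*} [CommMonoid R] (g : ℤ → R) (x : ℤ) (l : List ℤ) (e : ℕ) (k : List ℕ) :
    zpow g (x :: l) (e :: k) = g x ^ e * zpow g l k := by
  simp [zpow]

lemma prod_toFinset_pow {R : Type*} [CommMonoid R] (g : ℤ → R) {l : List ℤ} (hl : l.Nodup)
    (e : ℤ → ℕ) : ∏ n ∈ l.toFinset, g n ^ e n = zpow g l (l.map e) := by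
  rw [List.prod_toFinset _ hl]
  clear hl
  induction l with
  | nil => simp [zpow]
  | cons x l ih => simp [zpow_cons, ih]

lemma exists_map_eq {l : List ℤ} (hl : l.Nodup) {k : List ℕ} (h : l.length = k.length) :
    ∃ e : ℤ → ℕ, l.map e = k := by
  induction l generalizing k with
  | nil => exact ⟨fun _ => 0, by simpa using (List.length_eq_zero_iff.1 h.symm).symm⟩
  | cons x l ih =>
    cases k with
    | nil => simp at h
    | cons a k =>
      rw [List.nodup_cons] at hl
      obtain ⟨e, he⟩ := ih hl.2 (by simpa using h)
      refine ⟨Function.update e x a, ?_⟩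
      rw [List.map_cons, Function.update_self, ← he]
      congr 1
      refine List.map_congr_left fun y hy => ?_
      rw [Function.update_of_ne]
      rintro rfl; exact hl.1 hy

lemma sum_map_eq_sum_range {E : Type*} [AddCommMonoid E] (F : ℤ → E) (l : List ℤ) :
    (l.map F).sum = ∑ j ∈ Finset.range l.length, F (l.getD j 0) := by
  induction l with
  | nil => simp
  | cons x l ih =>
    rw [List.map_cons, List.sum_cons, List.length_cons, Finset.sum_range_succ', ih, add_comm]
    simp

/-- The contribution of the `j`-th entry to the sum over translates of `l`. -/
noncomputable def pivotVal (l : List ℤ) (k : List ℕ) (j : ℕ) : ℝ :=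
  PowerSeries.coeff (k.getD j 0) (betaSeries *
    zpow (fun n => invLin ((n - l.getD j 0 : ℤ) : ℝ)) (l.eraseIdx j) (k.eraseIdx j))

/-- The partial sums over the translates of `l`. -/
noncomputable def listSum (l : List ℤ) (k : List ℕ) (N : ℕ) : ℝ :=
  ∑ c ∈ Finset.Icc (-(N : ℤ)) N with ∀ n ∈ l, c + n ≠ 0, invMonomial (l.map (c + ·)) k

lemma tendsto_listSum {l : List ℤ} (hl : l.Nodup) {k : List ℕ} (h : l.length = k.length)
    (hk : ∀ i ∈ k, 0 < i) (hne : k ≠ []) :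
    Tendsto (listSum l k) atTop (𝓝 (∑ j ∈ Finset.range l.length, pivotVal l k j)) := by
  obtain ⟨e, rfl⟩ := exists_map_eq hl h
  have h1 : transSum l.toFinset e = listSum l (l.map e) := by
    ext N
    unfold transSum listSum
    refine Finset.sum_congr (by ext c; simp) fun c _ => ?_
    rw [prod_toFinset_pow (fun n => ((c + n : ℤ) : ℝ)⁻¹) hl, ← zpow_inv, zpow_map]
  have h2 : transVal l.toFinset e = ∑ j ∈ Finset.range l.length, pivotVal l (l.map e) j := by
    unfold transVal
    rw [List.sum_toFinset _ hl, sum_map_eq_sum_range]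
    refine Finset.sum_congr rfl fun j hj => ?_
    have hj' : j < l.length := Finset.mem_range.1 hj
    have h3 : l.toFinset.erase (l.getD j 0) = (l.eraseIdx j).toFinset := by
      ext x
      rw [Finset.mem_erase, List.mem_toFinset, List.mem_toFinset,
        ← hl.erase_getElem j hj', hl.mem_erase_iff, List.getD_eq_getElem _ _ hj']
    unfold pivotVal
    rw [h3, prod_toFinset_pow (fun n => invLin ((n - l.getD j 0 : ℤ) : ℝ))
      (hl.sublist (List.eraseIdx_sublist _ _)), List.eraseIdx_map]
    congr 2
    rw [List.getD_eq_getElem _ _ hj', List.getD_eq_getElem _ _ (by simpa using hj')]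
    simp
  rw [← h1, ← h2]
  refine tendsto_transSum ?_
  obtain ⟨x, hx⟩ := List.exists_mem_of_ne_nil _ hne
  obtain ⟨a, ha, rfl⟩ := List.mem_map.1 hx
  exact ⟨a, by simpa using ha, (hk _ hx).ne'⟩

lemma pivotVal_map_add (l : List ℤ) (c : ℤ) (k : List ℕ) {j : ℕ} (hj : j < l.length) :
    pivotVal (l.map (c + ·)) k j = pivotVal l k j := by
  unfold pivotVal
  have h1 : (l.map (c + ·)).getD j 0 = c + l.getD j 0 := by
    rw [List.getD_eq_getElem _ _ hj, List.getD_eq_getElem _ _ (by simpa using hj)]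
    simp
  rw [List.eraseIdx_map, zpow_map, h1]
  simp only [add_sub_add_left_eq_sub]

lemma pivotVal_append (l l' : List ℤ) (k : List ℕ) :
    pivotVal (l ++ 0 :: l') k l.length = PowerSeries.coeff (k.getD l.length 0) (betaSeries *
      zpow (fun n => invLin n) (l ++ l') (k.eraseIdx l.length)) := by
  unfold pivotVal
  have h1 : (l ++ 0 :: l').getD l.length 0 = 0 := by
    simp
  rw [h1, List.eraseIdx_append_of_length_le le_rfl]
  simp

lemma coeff_invLin (x : ℝ) (n : ℕ) :
    PowerSeries.coeff n (invLin x) = (-1) ^ n * x⁻¹ ^ (n + 1) := by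
  by_cases hx : x = 0
  · subst hx
    have : invLin 0 = 0 := by
      rw [invLin, PowerSeries.inv_eq_zero]; simp
    simp [this]
  · have h : invLin x = PowerSeries.mk fun n => (-1) ^ n * x⁻¹ ^ (n + 1) := by
      unfold invLin
      rw [eq_comm, PowerSeries.eq_inv_iff_mul_eq_one (by simpa using hx)]
      ext n
      rw [mul_add, map_add, mul_comm _ (PowerSeries.C x), PowerSeries.coeff_C_mul]
      cases n with
      | zero => simp [hx]
      | succ n =>
        rw [PowerSeries.coeff_succ_mul_X]
        simp only [PowerSeries.coeff_mk, PowerSeries.coeff_one]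
        simp only [Nat.succ_ne_zero, if_false]
        rw [pow_succ x⁻¹ (n + 1), pow_succ (-1 : ℝ) n]
        field_simp
        ring
    rw [h, PowerSeries.coeff_mk]

lemma exists_coeff_invLin_pow (e s : ℕ) :
    ∃ q : ℚ, ∀ x : ℝ, PowerSeries.coeff s (invLin x ^ e) = q * x⁻¹ ^ (e + s) := by
  induction e generalizing s with
  | zero =>
    refine ⟨if s = 0 then 1 else 0, fun x => ?_⟩
    rw [pow_zero, PowerSeries.coeff_one]
    split_ifs with h <;> simp [h]
  | succ e ih =>
    choose q hq using ih
    refine ⟨∑ p ∈ Finset.HasAntidiagonal.antidiagonal s, q p.1 * (-1) ^ p.2, fun x => ?_⟩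
    rw [pow_succ, PowerSeries.coeff_mul]
    push_cast
    rw [Finset.sum_mul]
    refine Finset.sum_congr rfl fun p hp => ?_
    rw [Finset.HasAntidiagonal.mem_antidiagonal] at hp
    rw [hq, coeff_invLin, ← hp, show e + 1 + (p.1 + p.2) = (e + p.1) + (p.2 + 1) by ring, pow_add]
    ring

/-- Rational combinations of monomials whose exponents dominate `k` and have total excess `m`,
as functions on lists of the length of `k`. -/
noncomputable def monomialSpan (k : List ℕ) (m : ℕ) : Submodule ℚ (List ℤ → ℝ) :=
  Submodule.span ℚ {H | (∀ l : List ℤ, l.length = k.length → H l = 0) ∨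
    ∃ u : List ℕ, List.Forall₂ (· ≤ ·) k u ∧ u.sum = k.sum + m ∧
      ∀ l : List ℤ, l.length = k.length → H l = invMonomial l u}

lemma mem_monomialSpan_congr {k : List ℕ} {m : ℕ} {H H' : List ℤ → ℝ} (hH : H ∈ monomialSpan k m)
    (h : ∀ l : List ℤ, l.length = k.length → H' l = H l) : H' ∈ monomialSpan k m := by
  have : H' - H ∈ monomialSpan k m :=
    Submodule.subset_span (Or.inl fun l hl => by simp [h l hl])
  simpa using Submodule.add_mem _ this hH

/-- Multiplication by a power of the inverse of the first entry. -/
noncomputable def consMul (e : ℕ) : (List ℤ → ℝ) →ₗ[ℚ] (List ℤ → ℝ) where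
  toFun H l := ((l.headD 0 : ℤ) : ℝ)⁻¹ ^ e * H l.tail
  map_add' H H' := by ext l; simp [mul_add]
  map_smul' c H := by ext l; simp [Rat.smul_def]; ring

lemma consMul_mem {k : List ℕ} {m : ℕ} {H : List ℤ → ℝ} (hH : H ∈ monomialSpan k m) (e s : ℕ) :
    consMul (e + s) H ∈ monomialSpan (e :: k) (s + m) := by
  have : (monomialSpan k m).map (consMul (e + s)) ≤ monomialSpan (e :: k) (s + m) := by
    rw [monomialSpan, Submodule.map_span, Submodule.span_le]
    rintro _ ⟨H, h | ⟨u, h1, h2, h3⟩, rfl⟩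
    · refine Submodule.subset_span (Or.inl fun l hl => ?_)
      cases l with
      | nil => simp at hl
      | cons x l => simp [consMul, h l (by simpa using hl)]
    · refine Submodule.subset_span (Or.inr ⟨(e + s) :: u, .cons (by omega) h1, ?_, ?_⟩)
      · simp [h2]; ring
      intro l hl
      cases l with
      | nil => simp at hl
      | cons x l => simp [consMul, h3 l (by simpa using hl)]
  exact this (Submodule.mem_map_of_mem hH)

lemma coeff_zpow_invLin_mem (k : List ℕ) (m : ℕ) :
    (fun l : List ℤ => PowerSeries.coeff m (zpow (fun n => invLin n) l k)) ∈ monomialSpan k m := by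
  induction k generalizing m with
  | nil =>
    by_cases hm : m = 0
    · subst hm
      refine Submodule.subset_span (Or.inr ⟨[], .nil, by simp, fun l _ => ?_⟩)
      simp [zpow, invMonomial]
    · refine Submodule.subset_span (Or.inl fun l _ => ?_)
      simp [zpow, PowerSeries.coeff_one, hm]
  | cons e k ih =>
    choose q hq using exists_coeff_invLin_pow e
    refine mem_monomialSpan_congr (H := ∑ p ∈ Finset.HasAntidiagonal.antidiagonal m, q p.1 • consMul (e + p.1)
      (fun l : List ℤ => PowerSeries.coeff p.2 (zpow (fun n => invLin n) l k))) ?_ ?_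
    · refine Submodule.sum_mem _ fun p hp => Submodule.smul_mem _ _ ?_
      rw [Finset.HasAntidiagonal.mem_antidiagonal] at hp
      rw [← hp]
      exact consMul_mem (ih p.2) e p.1
    · intro l hl
      cases l with
      | nil => simp at hl
      | cons x l =>
        rw [zpow_cons, PowerSeries.coeff_mul, Finset.sum_apply]
        refine Finset.sum_congr rfl fun p _ => ?_
        simp [hq, consMul, Rat.smul_def, mul_assoc]

/-- The list with negated entries in reversed order. -/
def negrev (p : List ℤ) : List ℤ := (p.map (fun x => -x)).reverse

@[simp] lemma negrev_negrev (p : List ℤ) : negrev (negrev p) = p := by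
  simp [negrev, List.map_reverse]

@[simp] lemma length_negrev (p : List ℤ) : (negrev p).length = p.length := by simp [negrev]

@[simp] lemma mem_negrev {p : List ℤ} {x : ℤ} : x ∈ negrev p ↔ -x ∈ p := by
  simp only [negrev, List.mem_reverse, List.mem_map]
  constructor
  · rintro ⟨a, ha, rfl⟩; simpa using ha
  · intro h; exact ⟨-x, h, by simp⟩

lemma pairwise_negrev {p : List ℤ} : (negrev p).Pairwise (· < ·) ↔ p.Pairwise (· < ·) := by
  simp [negrev, List.pairwise_reverse, List.pairwise_map]

/-- Pairs of chains in `(0, M]` all of whose mutual sums are at most `M`. -/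
noncomputable def compatPairs (i j M : ℕ) : Finset (List ℤ × List ℤ) :=
  (chains i 0 M ×ˢ chains j 0 M).filter fun z => ∀ x ∈ z.1, ∀ y ∈ z.2, x + y ≤ M

lemma mem_compatPairs {i j M : ℕ} {z : List ℤ × List ℤ} : z ∈ compatPairs i j M ↔
    (z.1.length = i ∧ z.1.Pairwise (· < ·) ∧ ∀ x ∈ z.1, 0 < x ∧ x ≤ M) ∧
    (z.2.length = j ∧ z.2.Pairwise (· < ·) ∧ ∀ x ∈ z.2, 0 < x ∧ x ≤ M) ∧
    ∀ x ∈ z.1, ∀ y ∈ z.2, x + y ≤ M := by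
  simp [compatPairs, mem_chains, and_assoc]

/-- Chains in `[-M, M]` of diameter at most `M`. -/
noncomputable def narrowChains (d M : ℕ) : Finset (List ℤ) :=
  (chains d (-(M : ℤ) - 1) M).filter fun l => ∀ x ∈ l, ∀ y ∈ l, y - x ≤ M

lemma mem_narrowChains {d M : ℕ} {l : List ℤ} : l ∈ narrowChains d M ↔
    l.length = d ∧ l.Pairwise (· < ·) ∧ (∀ x ∈ l, -(M : ℤ) ≤ x ∧ x ≤ M) ∧
      ∀ x ∈ l, ∀ y ∈ l, y - x ≤ M := by
  have : ∀ x : ℤ, -(M : ℤ) - 1 < x ↔ -(M : ℤ) ≤ x := fun x => by omega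
  simp [narrowChains, mem_chains, and_assoc, this]

lemma filter_append_filter {l : List ℤ} (hl : l.Pairwise (· < ·)) (h0 : (0 : ℤ) ∉ l) :
    l.filter (· < 0) ++ l.filter (0 < ·) = l := by
  induction l with
  | nil => rfl
  | cons x l ih =>
    rw [List.pairwise_cons] at hl
    simp only [List.mem_cons, not_or] at h0
    rcases lt_or_gt_of_ne h0.1 with hx | hx
    · have h1 : (x :: l).filter (· < 0) = [] := by
        simp only [List.filter_eq_nil_iff, List.mem_cons, decide_eq_true_eq, not_lt]
        rintro a (rfl | ha)
        · exact hx.le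
        · exact (hx.trans (hl.1 a ha)).le
      have h2 : (x :: l).filter (0 < ·) = x :: l := by
        simp only [List.filter_eq_self, List.mem_cons, decide_eq_true_eq]
        rintro a (rfl | ha)
        · exact hx
        · exact hx.trans (hl.1 a ha)
      rw [h1, h2, List.nil_append]
    · rw [List.filter_cons_of_pos (by simpa using hx), List.filter_cons_of_neg (by simpa using hx.le),
        List.cons_append, ih hl.2 h0.2]

lemma sum_narrowChains_ne_zero (d M : ℕ) (F : List ℤ → ℝ) :
    ∑ l ∈ narrowChains d M with (0 : ℤ) ∉ l, F l =
      ∑ i ∈ Finset.range (d + 1), ∑ z ∈ compatPairs i (d - i) M, F (negrev z.1 ++ z.2) := by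
  rw [Finset.sum_sigma']
  refine Finset.sum_nbij' (fun l => ⟨(l.filter (· < 0)).length,
    (negrev (l.filter (· < 0)), l.filter (0 < ·))⟩) (fun s => negrev s.2.1 ++ s.2.2) ?_ ?_ ?_ ?_ ?_
  · intro l hl
    rw [Finset.mem_filter, mem_narrowChains] at hl
    obtain ⟨⟨h1, h2, h3, h4⟩, h5⟩ := hl
    have h6 := congrArg List.length (filter_append_filter h2 h5)
    rw [List.length_append] at h6
    simp only [Finset.mem_sigma, Finset.mem_range, mem_compatPairs, length_negrev, pairwise_negrev,
      true_and, mem_negrev, List.mem_filter, decide_eq_true_eq]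
    refine ⟨by omega, ⟨h2.filter _, fun x hx => ?_⟩, ⟨by omega, h2.filter _, fun x hx => ?_⟩, ?_⟩
    · have := h3 _ hx.1; omega
    · have := h3 _ hx.1; omega
    · intro x hx y hy
      have := h4 _ hx.1 _ hy.1; omega
  · rintro ⟨i, p, q⟩ h
    simp only [Finset.mem_sigma, Finset.mem_range, mem_compatPairs] at h
    obtain ⟨hi, ⟨h1, h2, h3⟩, ⟨h4, h5, h6⟩, h7⟩ := h
    rw [Finset.mem_filter, mem_narrowChains]
    simp only [List.length_append, length_negrev, List.pairwise_append, pairwise_negrev,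
      List.mem_append, mem_negrev, neg_zero]
    refine ⟨⟨by omega, ⟨h2, h5, fun x hx y hy => ?_⟩, ?_, ?_⟩, ?_⟩
    · have := h3 _ hx; have := h6 _ hy; omega
    · rintro x (hx | hx)
      · have := h3 _ hx; omega
      · have := h6 _ hx; omega
    · rintro x (hx | hx) y (hy | hy)
      · have := h3 _ hx; have := h3 _ hy; omega
      · have := h7 _ hx _ hy; omega
      · have := h6 _ hx; have := h3 _ hy; omega
      · have := h6 _ hx; have := h6 _ hy; omega
    · rintro (h | h)
      · have := h3 _ h; omega
      · have := h6 _ h; omega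
  · intro l hl
    rw [Finset.mem_filter, mem_narrowChains] at hl
    simp [filter_append_filter hl.1.2.1 hl.2]
  · rintro ⟨i, p, q⟩ h
    simp only [Finset.mem_sigma, Finset.mem_range, mem_compatPairs] at h
    obtain ⟨hi, ⟨h1, h2, h3⟩, ⟨h4, h5, h6⟩, h7⟩ := h
    have a1 : (negrev p).filter (· < 0) = negrev p := by
      simp only [List.filter_eq_self, decide_eq_true_eq, mem_negrev]
      intro a ha; have := h3 _ ha; omega
    have a2 : (negrev p).filter (0 < ·) = [] := by
      simp only [List.filter_eq_nil_iff, decide_eq_true_eq, mem_negrev]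
      intro a ha; have := h3 _ ha; omega
    have a3 : q.filter (0 < ·) = q := by
      simp only [List.filter_eq_self, decide_eq_true_eq]
      intro a ha; have := h6 _ ha; omega
    have a4 : q.filter (· < 0) = [] := by
      simp only [List.filter_eq_nil_iff, decide_eq_true_eq]
      intro a ha; have := h6 _ ha; omega
    simp [List.filter_append, a1, a2, a3, a4, h1]
  · intro l hl
    rw [Finset.mem_filter, mem_narrowChains] at hl
    simp [filter_append_filter hl.1.2.1 hl.2]

lemma sum_narrowChains_pivot (i j M : ℕ) (F : List ℤ → ℝ) :
    ∑ l ∈ narrowChains (i + j + 1) M with l.getD i 0 = 0, F l =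
      ∑ z ∈ compatPairs i j M, F (negrev z.1 ++ 0 :: z.2) := by
  have key : ∀ l ∈ (narrowChains (i + j + 1) M).filter (fun l => l.getD i 0 = 0),
      l.take i ++ 0 :: l.drop (i + 1) = l := by
    intro l hl
    rw [Finset.mem_filter, mem_narrowChains] at hl
    obtain ⟨⟨h1, -⟩, h5⟩ := hl
    rw [List.getD_eq_getElem _ _ (by omega)] at h5
    rw [← h5, ← List.drop_eq_getElem_cons, List.take_append_drop]
  refine Finset.sum_nbij' (fun l => (negrev (l.take i), l.drop (i + 1)))
    (fun s => negrev s.1 ++ 0 :: s.2) ?_ ?_ ?_ ?_ ?_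
  · intro l hl
    have h := key l hl
    rw [Finset.mem_filter, mem_narrowChains] at hl
    obtain ⟨⟨h1, h2, h3, h4⟩, h5⟩ := hl
    have hp : (l.take i).length = i := by simp; omega
    have hq : (l.drop (i + 1)).length = j := by simp; omega
    generalize l.take i = p at h hp ⊢
    generalize l.drop (i + 1) = q at h hq ⊢
    subst h
    simp only [List.pairwise_append, List.pairwise_cons, List.mem_append, List.mem_cons] at h2 h3 h4
    simp only [mem_compatPairs, length_negrev, pairwise_negrev, mem_negrev]
    refine ⟨⟨hp, h2.1, fun x hx => ?_⟩, ⟨hq, h2.2.1.2, fun x hx => ?_⟩, fun x hx y hy => ?_⟩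
    · have := h3 _ (Or.inl hx); have := h2.2.2 _ hx 0 (Or.inl rfl); omega
    · have := h3 _ (Or.inr (Or.inr hx)); have := h2.2.1.1 _ hx; omega
    · have := h4 _ (Or.inl hx) _ (Or.inr (Or.inr hy)); omega
  · rintro ⟨p, q⟩ h
    rw [mem_compatPairs] at h
    obtain ⟨⟨h1, h2, h3⟩, ⟨h4, h5, h6⟩, h7⟩ := h
    dsimp only at h1 h2 h3 h4 h5 h6 h7
    rw [Finset.mem_filter, mem_narrowChains]
    simp only [List.length_append, length_negrev, List.pairwise_append, pairwise_negrev,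
      List.mem_append, mem_negrev, List.length_cons, List.pairwise_cons, List.mem_cons]
    refine ⟨⟨by omega, ⟨h2, ⟨fun x hx => (h6 x hx).1, h5⟩, ?_⟩, ?_, ?_⟩, ?_⟩
    · rintro x hx y (rfl | hy)
      · have := h3 _ hx; omega
      · have := h3 _ hx; have := h6 _ hy; omega
    · rintro x (hx | rfl | hx)
      · have := h3 _ hx; omega
      · omega
      · have := h6 _ hx; omega
    · rintro x (hx | rfl | hx) y (hy | rfl | hy)
      · have := h3 _ hx; have := h3 _ hy; omega
      · have := h3 _ hx; omega
      · have := h7 _ hx _ hy; omega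
      · have := h3 _ hy; omega
      · omega
      · have := h6 _ hy; omega
      · have := h6 _ hx; have := h3 _ hy; omega
      · have := h6 _ hx; omega
      · have := h6 _ hx; have := h6 _ hy; omega
    · rw [← h1, ← length_negrev]; simp
  · intro l hl
    simp [-negrev_negrev, negrev_negrev, key l hl]
  · rintro ⟨p, q⟩ h
    rw [mem_compatPairs] at h
    have h1 : (negrev p).length = i := by simpa using h.1.1
    simp [← h1, -length_negrev]
  · intro l hl
    simp [key l hl]

lemma map_sub_mem_narrowChains {d M : ℕ} {l : List ℤ} (hl : l ∈ narrowChains d M) {i : ℕ}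
    (hi : i < d) : l.map (fun x => -l.getD i 0 + x) ∈
      (narrowChains d M).filter (fun l => l.getD i 0 = 0) := by
  rw [mem_narrowChains] at hl
  obtain ⟨h1, h2, h3, h4⟩ := hl
  have hi' : i < l.length := by omega
  have hm : l.getD i 0 ∈ l := by rw [List.getD_eq_getElem _ _ hi']; exact List.getElem_mem _
  rw [Finset.mem_filter, mem_narrowChains]
  generalize hx : l.getD i 0 = x at hm
  refine ⟨⟨by simpa using h1, by simpa [List.pairwise_map] using h2, ?_, ?_⟩, ?_⟩
  · simp only [List.mem_map]
    rintro _ ⟨y, hy, rfl⟩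
    have := h4 _ hm _ hy; have := h4 _ hy _ hm; omega
  · simp only [List.mem_map]
    rintro _ ⟨y, hy, rfl⟩ _ ⟨z, hz, rfl⟩
    have := h4 _ hy _ hz; omega
  · rw [List.getD_eq_getElem _ _ hi'] at hx
    rw [List.getD_eq_getElem _ _ (by simpa using hi'), List.getElem_map, hx]
    omega

lemma sum_pivot_eq_sum_pivot {d M i j : ℕ} (hi : i < d) (hj : j < d) (F : List ℤ → ℝ)
    (hF : ∀ (l : List ℤ) (c : ℤ), l.length = d → F (l.map (c + ·)) = F l) :
    ∑ l ∈ narrowChains d M with l.getD i 0 = 0, F l =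
      ∑ l ∈ narrowChains d M with l.getD j 0 = 0, F l := by
  have key : ∀ {i j : ℕ}, i < d → j < d → ∀ l ∈ (narrowChains d M).filter (fun l => l.getD i 0 = 0),
      (l.map (fun x => -l.getD j 0 + x)).map
        (fun x => -(l.map (fun x => -l.getD j 0 + x)).getD i 0 + x) = l := by
    intro i j hi hj l hl
    rw [Finset.mem_filter, mem_narrowChains] at hl
    have h : (l.map (fun x => -l.getD j 0 + x)).getD i 0 = -l.getD j 0 := by
      have := hl.2
      rw [List.getD_eq_getElem _ _ (by omega)] at this
      rw [List.getD_eq_getElem _ _ (by simp; omega), List.getElem_map, this, add_zero]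
    rw [h]
    simp
  refine Finset.sum_nbij' (fun l => l.map (fun x => -l.getD j 0 + x))
    (fun l => l.map (fun x => -l.getD i 0 + x)) ?_ ?_ ?_ ?_ ?_
  · intro l hl; exact map_sub_mem_narrowChains (Finset.mem_filter.1 hl).1 hj
  · intro l hl; exact map_sub_mem_narrowChains (Finset.mem_filter.1 hl).1 hi
  · exact key hi hj
  · exact key hj hi
  · intro l hl
    exact (hF _ _ (mem_narrowChains.1 (Finset.mem_filter.1 hl).1).1).symm

lemma sum_chains_eq_sum_compatPairs (i j M : ℕ) (F : List ℤ → ℝ)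
    (hF : ∀ (l : List ℤ) (c : ℤ), l.length = i + j + 1 → F (l.map (c + ·)) = F l) :
    ∑ t ∈ chains (i + j) 0 M, F (0 :: t) = ∑ z ∈ compatPairs i j M, F (negrev z.1 ++ 0 :: z.2) := by
  rw [← sum_narrowChains_pivot, sum_pivot_eq_sum_pivot (j := 0) (by omega) (by omega) F hF]
  have h := sum_narrowChains_pivot 0 (i + j) M F
  rw [zero_add] at h
  rw [h]
  refine Finset.sum_nbij' (fun t => ([], t)) (fun z => z.2) ?_ ?_ ?_ ?_ ?_
  · intro t ht
    rw [mem_chains] at ht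
    rw [mem_compatPairs]
    simpa using ht
  · intro z hz
    rw [mem_compatPairs] at hz
    rw [mem_chains]
    exact hz.2.1
  · intro t _; rfl
  · rintro ⟨p, q⟩ hz
    rw [mem_compatPairs] at hz
    have hp : p = [] := List.length_eq_zero_iff.1 hz.1.1
    simp [hp]
  · intro t _; rfl

lemma sum_narrowChains_eq_sum_window (d M : ℕ) (F : List ℤ → ℝ) :
    ∑ l ∈ narrowChains (d + 1) M with (0 : ℤ) ∉ l, F l = ∑ t ∈ chains d 0 M,
      ∑ c ∈ Finset.Icc (-(M : ℤ)) M with ∀ n ∈ 0 :: t, c + n ≠ 0 ∧ c + n ≤ M,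
        F ((0 :: t).map (c + ·)) := by
  rw [Finset.sum_sigma']
  have key : ∀ l ∈ (narrowChains (d + 1) M).filter (fun l => (0 : ℤ) ∉ l),
      (0 :: l.tail.map (-l.headD 0 + ·)).map (l.headD 0 + ·) = l := by
    intro l hl
    rw [Finset.mem_filter, mem_narrowChains] at hl
    cases l with
    | nil => simp at hl
    | cons x l => simp
  refine Finset.sum_nbij' (fun l => ⟨l.tail.map (-l.headD 0 + ·), l.headD 0⟩)
    (fun s => (0 :: s.1).map (s.2 + ·)) ?_ ?_ key ?_ ?_
  · intro l hl
    rw [Finset.mem_filter, mem_narrowChains] at hl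
    obtain ⟨⟨h1, h2, h3, h4⟩, h5⟩ := hl
    cases l with
    | nil => simp at h1
    | cons x l =>
      simp only [List.pairwise_cons, List.mem_cons, forall_eq_or_imp, not_or] at h2 h3 h4 h5
      simp only [Finset.mem_sigma, mem_chains, Finset.mem_filter, List.tail_cons, List.headD_cons,
        List.length_map, List.pairwise_map, List.mem_cons, forall_eq_or_imp, List.mem_map,
        Finset.mem_Icc, forall_exists_index, and_imp, forall_apply_eq_imp_iff₂]
      refine ⟨⟨by simpa using h1, by simpa using h2.2, fun a ha => ?_⟩, h3.1, ?_, fun a ha => ?_⟩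
      · have := h2.1 a ha; have := h4.1.2 a ha; omega
      · have := h3.1; omega
      · have := h3.2 a ha
        refine ⟨?_, by omega⟩
        rintro h
        apply h5.2
        convert ha using 1; omega
  · rintro ⟨t, c⟩ h
    simp only [Finset.mem_sigma, mem_chains, Finset.mem_filter, List.mem_cons, forall_eq_or_imp,
      Finset.mem_Icc] at h
    obtain ⟨⟨h1, h2, h3⟩, h4, h5, h6⟩ := h
    rw [Finset.mem_filter, mem_narrowChains]
    simp only [List.map_cons, List.length_cons, List.length_map, List.pairwise_cons,
      List.pairwise_map, List.mem_cons, forall_eq_or_imp, List.mem_map,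
      forall_exists_index, and_imp, forall_apply_eq_imp_iff₂, not_or, not_exists, not_and]
    refine ⟨⟨by omega, ⟨fun a ha => ?_, by simpa using h2⟩, ⟨by omega, fun a ha => ?_⟩,
      ⟨by omega, fun a ha => ?_⟩, fun a ha => ⟨?_, fun b hb => ?_⟩⟩, by omega, fun a ha => ?_⟩
    · have := h3 a ha; omega
    · have := h3 a ha; have := h6 a ha; omega
    · have := h3 a ha; omega
    · have := h3 a ha; omega
    · have := h3 a ha; have := h3 b hb; omega
    · exact (h6 a ha).1
  · rintro ⟨t, c⟩ h
    simp [Function.comp_def]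
  · intro l hl
    rw [key l hl]

lemma negligible_of_le {e f : ℕ → ℝ} (hf : f ∈ negligible) (h : ∀ M : ℕ, 0 < M → |e M| ≤ f M) :
    e ∈ negligible := by
  intro j
  refine squeeze_zero_norm' ?_ (hf j)
  filter_upwards [eventually_gt_atTop 0] with M hM
  rw [norm_mul, Real.norm_eq_abs, Real.norm_eq_abs, abs_of_nonneg (pow_nonneg (harm_nonneg M) j)]
  exact mul_le_mul_of_nonneg_right (h M hM) (pow_nonneg (harm_nonneg M) j)

lemma sum_chains_succ_last (d : ℕ) (a b : ℤ) (F : List ℤ → ℝ) :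
    ∑ l ∈ chains (d + 1) a b, F l =
      ∑ m ∈ Finset.Ioc a b, ∑ t ∈ chains d a (m - 1), F (t ++ [m]) := by
  rw [Finset.sum_sigma']
  have key : ∀ l ∈ chains (d + 1) a b, l.dropLast ++ [l.getLastD 0] = l := by
    intro l hl
    have hne : l ≠ [] := by
      rintro rfl; simp [mem_chains] at hl
    rw [List.getLastD_eq_getLast?, List.getLast?_eq_getLast_of_ne_nil hne, Option.getD_some,
      List.dropLast_append_getLast]
  refine Finset.sum_nbij' (fun l => ⟨l.getLastD 0, l.dropLast⟩) (fun s => s.2 ++ [s.1]) ?_ ?_ key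
    ?_ ?_
  · intro l hl
    have h := key l hl
    generalize l.getLastD 0 = m at h ⊢
    generalize l.dropLast = t at h ⊢
    subst h
    simp only [mem_chains, List.length_append, List.length_singleton, List.pairwise_append,
      List.mem_append, List.mem_singleton] at hl
    obtain ⟨h1, ⟨h2, -, h3⟩, h4⟩ := hl
    simp only [Finset.mem_sigma, Finset.mem_Ioc, mem_chains]
    refine ⟨h4 _ (Or.inr rfl), by omega, h2, fun x hx => ⟨(h4 x (Or.inl hx)).1, ?_⟩⟩
    have := h3 x hx m rfl; omega
  · rintro ⟨m, t⟩ h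
    simp only [Finset.mem_sigma, Finset.mem_Ioc, mem_chains] at h
    obtain ⟨h1, h2, h3, h4⟩ := h
    simp only [mem_chains, List.length_append, List.length_singleton, List.pairwise_append,
      List.mem_append, List.mem_singleton, List.pairwise_singleton, true_and]
    refine ⟨by omega, ⟨h3, ?_⟩, ?_⟩
    · rintro x hx y rfl
      have := h4 x hx; omega
    · rintro x (hx | rfl)
      · have := h4 x hx; omega
      · exact h1
  · rintro ⟨m, t⟩ h
    simp
  · intro l hl; rw [key l hl]

/-- The sum over compatible pairs of the product of two monomials. -/
noncomputable def pairSum (u v : List ℕ) (M : ℕ) : ℝ :=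
  ∑ z ∈ compatPairs u.length v.length M, invMonomial z.1 u * invMonomial z.2 v

lemma pairSum_eq (u v : List ℕ) (M : ℕ) : pairSum u v M = ∑ q ∈ chains v.length 0 M,
    invMonomial q v * ∑ p ∈ chains u.length 0 M with ∀ x ∈ p, ∀ y ∈ q, x + y ≤ M,
      invMonomial p u := by
  rw [pairSum, compatPairs, Finset.sum_filter, Finset.sum_product_right]
  refine Finset.sum_congr rfl fun q _ => ?_
  rw [Finset.mul_sum, Finset.sum_filter]
  refine Finset.sum_congr rfl fun p _ => ?_
  split_ifs <;> ring

lemma pairSum_nil_left (v : List ℕ) (M : ℕ) : pairSum [] v M = hseq v M := by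
  rw [pairSum_eq, hseq, hsum_eq_sum_chains]
  refine Finset.sum_congr rfl fun q _ => ?_
  rw [Finset.sum_filter, List.length_nil, sum_chains_zero]
  simp

lemma pairSum_nil_right (u : List ℕ) (M : ℕ) : pairSum u [] M = hseq u M := by
  rw [pairSum_eq, hseq, hsum_eq_sum_chains, List.length_nil, sum_chains_zero]
  simp

lemma pairSum_append_singleton (u v : List ℕ) (e M : ℕ) :
    pairSum u (v ++ [e]) M = ∑ m ∈ Finset.Ioc (0 : ℤ) M,
      hsum v 0 (m - 1) * ((m : ℝ)⁻¹) ^ e * hsum u 0 (M - m) := by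
  rw [pairSum_eq, List.length_append, List.length_singleton, sum_chains_succ_last]
  refine Finset.sum_congr rfl fun m hm => ?_
  rw [Finset.mem_Ioc] at hm
  rw [hsum_eq_sum_chains v, mul_assoc, Finset.sum_mul]
  refine Finset.sum_congr rfl fun t ht => ?_
  rw [mem_chains] at ht
  rw [invMonomial_append ht.1, hsum_eq_sum_chains, mul_assoc]
  congr 1
  rw [invMonomial_cons, invMonomial_nil, mul_one]
  congr 1
  refine Finset.sum_congr ?_ fun _ _ => rfl
  ext p
  simp only [Finset.mem_filter, mem_chains, List.mem_append, List.mem_singleton]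
  constructor
  · rintro ⟨⟨h1, h2, h3⟩, h4⟩
    refine ⟨h1, h2, fun x hx => ⟨(h3 x hx).1, ?_⟩⟩
    have := h4 x hx m (Or.inr rfl); omega
  · rintro ⟨h1, h2, h3⟩
    refine ⟨⟨h1, h2, fun x hx => ?_⟩, ?_⟩
    · have := h3 x hx; omega
    · rintro x hx y (hy | rfl)
      · have := h3 x hx; have := ht.2.2 y hy; omega
      · have := h3 x hx; omega

lemma hsum_sub_hsum_le (u : List ℕ) (hu : ∀ i ∈ u, 0 < i) {f : ℕ} (hf : 0 < f) {a : ℤ} (ha : 0 ≤ a)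
    (M : ℕ) (haM : a ≤ M) :
    0 ≤ hsum (u ++ [f]) 0 M - hsum (u ++ [f]) 0 a ∧
    hsum (u ++ [f]) 0 M - hsum (u ++ [f]) 0 a ≤
      harm M ^ u.length * ∑ m ∈ Finset.Ioc a M, (m : ℝ)⁻¹ := by
  have h1 : hsum (u ++ [f]) 0 M - hsum (u ++ [f]) 0 a =
      ∑ m ∈ Finset.Ioc a M, hsum u 0 (m - 1) * ((m : ℝ)⁻¹) ^ f := by
    rw [hsum_append_singleton, hsum_append_singleton, sub_eq_iff_eq_add, add_comm]
    rw [← Finset.sum_union]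
    · congr 1
      ext x; simp only [Finset.mem_union, Finset.mem_Ioc]; omega
    · refine Finset.disjoint_left.2 fun x hx hx' => ?_
      rw [Finset.mem_Ioc] at hx hx'; omega
  rw [h1]
  refine ⟨Finset.sum_nonneg fun m hm => ?_, ?_⟩
  · rw [Finset.mem_Ioc] at hm
    have : (0 : ℝ) < m := by exact_mod_cast (by omega : 0 < m)
    exact mul_nonneg (hsum_nonneg _ _ _ le_rfl) (by positivity)
  rw [Finset.mul_sum]
  refine Finset.sum_le_sum fun m hm => ?_
  rw [Finset.mem_Ioc] at hm
  have hm0 : 0 < m := by omega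
  have hm' : (0 : ℝ) < m := by exact_mod_cast hm0
  have h2 : hsum u 0 (m - 1) ≤ harm M ^ u.length := by
    refine le_trans ?_ (hsum_le_harm_pow u hu le_rfl M)
    have := hsum_mono u (M := (m - 1).toNat) (N := M) (by omega)
    rwa [Int.toNat_of_nonneg (by omega)] at this
  exact mul_le_mul h2 (inv_pow_le_inv hm0 hf) (by positivity) (pow_nonneg (harm_nonneg M) _)

lemma sum_inv_sq_mul_sum_inv_le (M : ℕ) (hM : 0 < M) :
    ∑ m ∈ Finset.Ioc (0 : ℤ) M, ((m : ℝ)⁻¹) ^ 2 * ∑ n ∈ Finset.Ioc ((M : ℤ) - m) M, (n : ℝ)⁻¹ ≤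
      (harm M ^ 2 + harm M) / M := by
  have hM' : (0 : ℝ) < M := by exact_mod_cast hM
  have h1 : ∀ m ∈ Finset.Ioc (0 : ℤ) M,
      ((m : ℝ)⁻¹) ^ 2 * ∑ n ∈ Finset.Ioc ((M : ℤ) - m) M, (n : ℝ)⁻¹ ≤
        (M : ℝ)⁻¹ * ((m : ℝ)⁻¹ * harm M + (m : ℝ)⁻¹) := by
    intro m hm
    rw [Finset.mem_Ioc] at hm
    have hm' : (0 : ℝ) < m := by exact_mod_cast hm.1
    have h2 : ∀ n ∈ Finset.Ioc ((M : ℤ) - m) M, (m : ℝ)⁻¹ * (n : ℝ)⁻¹ ≤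
        (M : ℝ)⁻¹ * ((n : ℝ)⁻¹ + (m : ℝ)⁻¹) := by
      intro n hn
      rw [Finset.mem_Ioc] at hn
      have hn' : (0 : ℝ) < n := by exact_mod_cast (by omega : 0 < n)
      have h3 : (M : ℝ) ≤ m + n := by exact_mod_cast (by omega : (M : ℤ) ≤ m + n)
      rw [inv_add_inv hn'.ne' hm'.ne', ← mul_inv, inv_mul_eq_div, div_div, inv_eq_one_div,
        div_le_div_iff₀ (by positivity) (by positivity)]
      nlinarith [mul_pos hn' hm']
    have h4 := Finset.sum_le_sum h2
    rw [← Finset.mul_sum, ← Finset.mul_sum, Finset.sum_add_distrib, Finset.sum_const,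
      Int.card_Ioc, sub_sub_cancel, nsmul_eq_mul] at h4
    have h5 : ((m.toNat : ℕ) : ℝ) * (m : ℝ)⁻¹ = 1 := by
      have : ((m.toNat : ℕ) : ℝ) = m := by exact_mod_cast Int.toNat_of_nonneg hm.1.le
      rw [this, mul_inv_cancel₀ hm'.ne']
    rw [h5] at h4
    have h6 := sum_Ioc_le_harm (a := (M : ℤ) - m) (by omega) M
    calc _ = (m : ℝ)⁻¹ * ((m : ℝ)⁻¹ * ∑ n ∈ Finset.Ioc ((M : ℤ) - m) M, (n : ℝ)⁻¹) := by ring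
      _ ≤ (m : ℝ)⁻¹ * ((M : ℝ)⁻¹ * (harm M + 1)) := by
        refine mul_le_mul_of_nonneg_left (h4.trans ?_) (by positivity)
        gcongr
      _ = _ := by ring
  refine (Finset.sum_le_sum h1).trans_eq ?_
  rw [← Finset.mul_sum, Finset.sum_add_distrib, ← Finset.sum_mul, ← harm_eq_sum]
  field_simp

lemma pairSum_sub_negligible {u v : List ℕ} (hu : ∀ i ∈ u, 0 < i) (hv : Admissible v) :
    pairSum u v - hseq u * hseq v ∈ negligible := by
  by_cases hu0 : u = []
  · subst hu0
    convert negligible.zero_mem using 1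
    ext M; simp [pairSum_nil_left, hseq, hsum]
  by_cases hv0 : v = []
  · subst hv0
    convert negligible.zero_mem using 1
    ext M; simp [pairSum_nil_right, hseq, hsum]
  obtain ⟨v, e, rfl, he⟩ := exists_eq_append_of_getLastD hv.2 hv0
  obtain ⟨u, f, rfl⟩ : ∃ u' f, u = u' ++ [f] := ⟨_, _, (List.dropLast_append_getLast hu0).symm⟩
  have hf : 0 < f := hu f (by simp)
  have hu' : ∀ i ∈ u, 0 < i := fun i hi => hu i (by simp [hi])
  have hv' : ∀ i ∈ v, 0 < i := fun i hi => hv.1 i (by simp [hi])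
  have hkey : ∀ M : ℕ, 0 < M → |(pairSum (u ++ [f]) (v ++ [e]) - hseq (u ++ [f]) * hseq (v ++ [e])) M| ≤
      harm M ^ (v.length + u.length) * ((harm M ^ 2 + harm M) / M) := by
    intro M hM
    have h1 : (pairSum (u ++ [f]) (v ++ [e]) - hseq (u ++ [f]) * hseq (v ++ [e])) M =
        -∑ m ∈ Finset.Ioc (0 : ℤ) M, hsum v 0 (m - 1) * ((m : ℝ)⁻¹) ^ e *
          (hsum (u ++ [f]) 0 M - hsum (u ++ [f]) 0 (M - m)) := by
      rw [Pi.sub_apply, Pi.mul_apply, pairSum_append_singleton, hseq, hseq,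
        hsum_append_singleton v, Finset.mul_sum, ← Finset.sum_sub_distrib, ← Finset.sum_neg_distrib]
      refine Finset.sum_congr rfl fun m _ => ?_
      ring
    rw [h1, abs_neg]
    refine (Finset.abs_sum_le_sum_abs _ _).trans ?_
    refine le_trans ?_ (mul_le_mul_of_nonneg_left (sum_inv_sq_mul_sum_inv_le M hM)
      (pow_nonneg (harm_nonneg M) _))
    rw [Finset.mul_sum]
    refine Finset.sum_le_sum fun m hm => ?_
    rw [Finset.mem_Ioc] at hm
    have hm' : (0 : ℝ) < m := by exact_mod_cast hm.1
    obtain ⟨h2, h3⟩ := hsum_sub_hsum_le u hu' hf (a := (M : ℤ) - m) (by omega) M (by omega)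
    have h4 : hsum v 0 (m - 1) ≤ harm M ^ v.length := by
      refine le_trans ?_ (hsum_le_harm_pow v hv' le_rfl M)
      have := hsum_mono v (M := (m - 1).toNat) (N := M) (by omega)
      rwa [Int.toNat_of_nonneg (by omega)] at this
    have h5 := hsum_nonneg v 0 (m - 1) le_rfl
    have hh := harm_nonneg M
    rw [abs_of_nonneg (by positivity)]
    have h6 := inv_pow_le_inv_sq hm.1 he
    calc _ ≤ harm M ^ v.length * ((m : ℝ)⁻¹) ^ 2 *
          (harm M ^ u.length * ∑ n ∈ Finset.Ioc ((M : ℤ) - m) M, (n : ℝ)⁻¹) := by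
          refine mul_le_mul (mul_le_mul h4 h6 (by positivity) (by positivity)) h3 h2 (by positivity)
      _ = _ := by rw [pow_add]; ring
  have h2 : (fun M : ℕ => harm M ^ (v.length + u.length + 2) / M) ∈ negligible := by
    refine negligible_of_abs_le_div 1 (v.length + u.length + 2) zero_le_one fun M _ => ?_
    rw [abs_of_nonneg (by have := harm_nonneg M; positivity), one_mul]
  have h3 : (fun M : ℕ => harm M ^ (v.length + u.length + 1) / M) ∈ negligible := by
    refine negligible_of_abs_le_div 1 (v.length + u.length + 1) zero_le_one fun M _ => ?_
    rw [abs_of_nonneg (by have := harm_nonneg M; positivity), one_mul]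
  refine negligible_of_le (negligible.add_mem h2 h3) fun M hM => (hkey M hM).trans_eq ?_
  simp only [Pi.add_apply]
  ring

lemma sum_Ioc_inv_sq_le {a : ℤ} (ha : 0 ≤ a) (b : ℤ) :
    ∑ q ∈ Finset.Ioc a b, ((q : ℝ)⁻¹) ^ 2 ≤ 2 * ((a + 1 : ℤ) : ℝ)⁻¹ := by
  have ha' : (0 : ℝ) < ((a + 1 : ℤ) : ℝ) := by exact_mod_cast (by omega : 0 < a + 1)
  rcases lt_or_ge b (a + 1) with hb | hb
  · rw [Finset.Ioc_eq_empty (by omega), Finset.sum_empty]; positivity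
  suffices h : ∑ q ∈ Finset.Ioc a b, ((q : ℝ)⁻¹) ^ 2 ≤ 2 * ((a + 1 : ℤ) : ℝ)⁻¹ - (b : ℝ)⁻¹ by
    have hb' : (0 : ℝ) < b := by exact_mod_cast (by omega : 0 < b)
    have : 0 < (b : ℝ)⁻¹ := by positivity
    linarith
  induction b, hb using Int.leInduction with
  | base =>
    have h1 : Finset.Ioc a (a + 1) = {a + 1} := by
      ext x; simp only [Finset.mem_Ioc, Finset.mem_singleton]; omega
    have h2 : ((a + 1 : ℤ) : ℝ)⁻¹ ≤ 1 :=
      inv_le_one_of_one_le₀ (by exact_mod_cast (by omega : 1 ≤ a + 1))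
    rw [h1, Finset.sum_singleton]
    have h3 : 0 < ((a + 1 : ℤ) : ℝ)⁻¹ := by positivity
    nlinarith
  | succ b hb ih =>
    have h1 : Finset.Ioc a (b + 1) = insert (b + 1) (Finset.Ioc a b) := by
      ext x; simp only [Finset.mem_Ioc, Finset.mem_insert]; omega
    rw [h1, Finset.sum_insert (by simp)]
    have hb' : (0 : ℝ) < b := by exact_mod_cast (by omega : 0 < b)
    have h2 : (((b + 1 : ℤ) : ℝ)⁻¹) ^ 2 ≤ (b : ℝ)⁻¹ - ((b + 1 : ℤ) : ℝ)⁻¹ := by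
      push_cast
      rw [inv_sub_inv hb'.ne' (by positivity), inv_pow, inv_eq_one_div,
        div_le_div_iff₀ (by positivity) (by positivity)]
      nlinarith
    linarith

lemma abs_inv_pow_le {x : ℤ} (hx : x ≠ 0) {e : ℕ} (he : 0 < e) :
    |((x : ℝ)⁻¹) ^ e| ≤ |(x : ℝ)|⁻¹ := by
  rw [abs_pow, abs_inv, ← Int.cast_abs]
  exact inv_pow_le_inv (abs_pos.2 hx) he

lemma abs_inv_pow_le_sq {x : ℤ} (hx : x ≠ 0) {e : ℕ} (he : 2 ≤ e) :
    |((x : ℝ)⁻¹) ^ e| ≤ (|(x : ℝ)|⁻¹) ^ 2 := by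
  rw [abs_pow, abs_inv, ← Int.cast_abs]
  exact inv_pow_le_inv_sq (abs_pos.2 hx) he

lemma abs_invMonomial_le {l : List ℤ} {k : List ℕ} (h : l.length = k.length) (hk : ∀ i ∈ k, 0 < i)
    (c : ℤ) (g : ℤ → ℝ) (hg : ∀ x ∈ l, c + x ≠ 0 ∧ |((c + x : ℤ) : ℝ)|⁻¹ ≤ g x) :
    |invMonomial (l.map (c + ·)) k| ≤ (l.map g).prod := by
  induction l generalizing k with
  | nil => simp
  | cons x l ih =>
    cases k with
    | nil => simp at h
    | cons a k =>
      simp only [List.mem_cons, forall_eq_or_imp] at hg hk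
      rw [List.map_cons, invMonomial_cons, abs_mul, List.map_cons, List.prod_cons]
      have h1 := abs_inv_pow_le hg.1.1 hk.1
      exact mul_le_mul (h1.trans hg.1.2) (ih (by simpa using h) hk.2 hg.2) (abs_nonneg _)
        ((by positivity : (0 : ℝ) ≤ |((c + x : ℤ) : ℝ)|⁻¹).trans hg.1.2)

lemma sum_chains_prod_le (d : ℕ) {a b : ℤ} {g : ℤ → ℝ} (hg : ∀ x ∈ Finset.Ioc a b, 0 ≤ g x) :
    ∑ t ∈ chains d a b, (t.map g).prod ≤ (∑ x ∈ Finset.Ioc a b, g x) ^ d := by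
  have h : ∀ a', a ≤ a' → ∑ t ∈ chains d a' b, (t.map g).prod ≤ (∑ x ∈ Finset.Ioc a b, g x) ^ d := by
    induction d with
    | zero => intro a' _; simp [sum_chains_zero]
    | succ d ih =>
      intro a' ha'
      have hs := Finset.Ioc_subset_Ioc_left (b := b) ha'
      rw [sum_chains_succ, pow_succ']
      calc _ ≤ ∑ m ∈ Finset.Ioc a' b, g m * (∑ x ∈ Finset.Ioc a b, g x) ^ d := by
            refine Finset.sum_le_sum fun m hm => ?_
            simp only [List.map_cons, List.prod_cons, ← Finset.mul_sum]
            have := Finset.mem_Ioc.1 hm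
            exact mul_le_mul_of_nonneg_left (ih m (by omega)) (hg m (hs hm))
        _ ≤ _ := by
            rw [← Finset.sum_mul]
            refine mul_le_mul_of_nonneg_right ?_ (pow_nonneg (Finset.sum_nonneg hg) _)
            exact Finset.sum_le_sum_of_subset_of_nonneg hs fun x hx _ => hg x hx
  exact h a le_rfl

/-- The weight `1 / x + 1 / (M + 1 - x)`. -/
noncomputable def twoSided (M : ℕ) (x : ℤ) : ℝ := (x : ℝ)⁻¹ + (((M : ℤ) + 1 - x : ℤ) : ℝ)⁻¹

lemma inv_le_twoSided {M : ℕ} {x : ℤ} (h0 : 0 < x) (h1 : x ≤ M) :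
    0 < (x : ℝ)⁻¹ ∧ 0 < (((M : ℤ) + 1 - x : ℤ) : ℝ)⁻¹ ∧
    (x : ℝ)⁻¹ ≤ twoSided M x ∧ (((M : ℤ) + 1 - x : ℤ) : ℝ)⁻¹ ≤ twoSided M x := by
  have h2 : 0 < (x : ℝ)⁻¹ := inv_pos.2 (by exact_mod_cast h0)
  have h3 : 0 < (((M : ℤ) + 1 - x : ℤ) : ℝ)⁻¹ :=
    inv_pos.2 (by exact_mod_cast (by omega : 0 < (M : ℤ) + 1 - x))
  unfold twoSided
  exact ⟨h2, h3, by linarith, by linarith⟩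

lemma sum_twoSided (M : ℕ) : ∑ x ∈ Finset.Ioc (0 : ℤ) M, twoSided M x = 2 * harm M := by
  have h : ∑ x ∈ Finset.Ioc (0 : ℤ) M, (((M : ℤ) + 1 - x : ℤ) : ℝ)⁻¹ = harm M := by
    rw [harm_eq_sum]
    refine Finset.sum_nbij' (fun x => (M : ℤ) + 1 - x) (fun x => (M : ℤ) + 1 - x) ?_ ?_ ?_ ?_ ?_
    · intro x hx; rw [Finset.mem_Ioc] at hx ⊢; omega
    · intro x hx; rw [Finset.mem_Ioc] at hx ⊢; omega
    · intro x _; simp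
    · intro x _; simp
    · intro x _; rfl
  simp only [twoSided, Finset.sum_add_distrib]
  rw [h, ← harm_eq_sum]; ring

lemma sum_left_tail_le {M : ℕ} {L : ℤ} (hL : L ≤ M) (N : ℤ) :
    ∑ c ∈ Finset.Ico (-N) (-(M : ℤ)), (|((c + L : ℤ) : ℝ)|⁻¹) ^ 2 ≤
      2 * (((M : ℤ) + 1 - L : ℤ) : ℝ)⁻¹ := by
  have h : ∑ c ∈ Finset.Ico (-N) (-(M : ℤ)), (|((c + L : ℤ) : ℝ)|⁻¹) ^ 2 =
      ∑ q ∈ Finset.Ioc ((M : ℤ) - L) (N - L), ((q : ℝ)⁻¹) ^ 2 := by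
    refine Finset.sum_nbij' (fun x => -x - L) (fun x => -x - L) ?_ ?_ ?_ ?_ ?_
    · intro x hx; simp only [Finset.mem_Ioc, Finset.mem_Ico] at hx ⊢; omega
    · intro x hx; simp only [Finset.mem_Ioc, Finset.mem_Ico] at hx ⊢; omega
    · intro x _; simp
    · intro x _; simp
    · intro x _
      rw [← abs_inv, sq_abs, show x + L = -(-x - L) by ring, Int.cast_neg, inv_neg, neg_sq]
  rw [h]
  refine (sum_Ioc_inv_sq_le (by omega) _).trans_eq ?_
  rw [show (M : ℤ) - L + 1 = M + 1 - L by ring]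

/-- The part of the sum over translates that stays inside `[-M, M]`. -/
noncomputable def windowSum (t : List ℤ) (k : List ℕ) (M : ℕ) : ℝ :=
  ∑ c ∈ Finset.Icc (-(M : ℤ)) M with ∀ n ∈ 0 :: t, c + n ≠ 0 ∧ c + n ≤ M,
    invMonomial ((0 :: t).map (c + ·)) k

lemma abs_listSum_sub_windowSum_le {a e : ℕ} {k : List ℕ} (ha : 0 < a) (hk : ∀ i ∈ k, 0 < i)
    (he : 2 ≤ e) {M N : ℕ} (hM : 0 < M) (hN : M ≤ N) {t : List ℤ} {L : ℤ}
    (ht : t ++ [L] ∈ chains (k.length + 1) 0 M) :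
    |listSum (0 :: (t ++ [L])) (a :: (k ++ [e])) N - windowSum (t ++ [L]) (a :: (k ++ [e])) M| ≤
      4 / M * ((t ++ [L]).map (twoSided M)).prod := by
  have hM' : (0 : ℝ) < M := by exact_mod_cast hM
  simp only [mem_chains, List.length_append, List.length_singleton, List.pairwise_append,
    List.mem_append, List.mem_singleton] at ht
  obtain ⟨h1, ⟨h2, -, h3⟩, h4⟩ := ht
  have h1' : t.length = k.length := by omega
  have hL := h4 L (Or.inr rfl)
  obtain ⟨hL1, hL2, hL3, hL4⟩ := inv_le_twoSided hL.1 hL.2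
  have hlt : ∀ x ∈ t, 0 < x ∧ x < L := fun x hx => ⟨(h4 x (Or.inl hx)).1, h3 x hx L rfl⟩
  set P := (t.map (twoSided M)).prod with hP
  have hP0 : 0 ≤ P := List.prod_nonneg fun y hy => by
    obtain ⟨x, hx, rfl⟩ := List.mem_map.1 hy
    have := inv_le_twoSided (h4 x (Or.inl hx)).1 (h4 x (Or.inl hx)).2
    exact this.1.le.trans this.2.2.1
  set f : ℤ → ℝ := fun c => invMonomial ((0 :: (t ++ [L])).map (c + ·)) (a :: (k ++ [e])) with hf
  have hfc : ∀ c, f c = ((c : ℝ)⁻¹) ^ a * (invMonomial (t.map (c + ·)) k *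
      (((c + L : ℤ) : ℝ)⁻¹) ^ e) := by
    intro c
    simp only [hf, List.map_cons, List.map_append, List.map_nil, invMonomial_cons]
    rw [invMonomial_append (by simpa using h1')]
    simp
  have hright : ∀ c : ℤ, (M : ℤ) - L < c → |f c| ≤ (M : ℝ)⁻¹ * P * ((c : ℝ)⁻¹) ^ 2 := by
    intro c hc
    have hc0 : 0 < c := by omega
    have hc' : (0 : ℝ) < c := by exact_mod_cast hc0
    have hcL : (M : ℝ) ≤ ((c + L : ℤ) : ℝ) := by exact_mod_cast (by omega : (M : ℤ) ≤ c + L)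
    have hcc : (c : ℝ) ≤ ((c + L : ℤ) : ℝ) := by exact_mod_cast (by omega : c ≤ c + L)
    have b1 := abs_inv_pow_le hc0.ne' ha
    have b2 := abs_invMonomial_le h1' hk c (twoSided M) fun x hx => by
      have hx' := hlt x hx
      refine ⟨by omega, le_trans ?_ (inv_le_twoSided hx'.1 (by omega)).2.2.1⟩
      have : (0 : ℝ) < x := by exact_mod_cast hx'.1
      have hcx : (x : ℝ) ≤ ((c + x : ℤ) : ℝ) := by exact_mod_cast (by omega : x ≤ c + x)
      rw [abs_of_pos (by linarith)]
      gcongr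
    have b3 := abs_inv_pow_le_sq (x := c + L) (by omega) he
    have b4 : (|((c + L : ℤ) : ℝ)|⁻¹) ^ 2 ≤ (M : ℝ)⁻¹ * (c : ℝ)⁻¹ := by
      have hcL0 : (0 : ℝ) < ((c + L : ℤ) : ℝ) := by linarith
      rw [abs_of_pos hcL0, sq]
      exact mul_le_mul (inv_anti₀ hM' hcL) (inv_anti₀ hc' hcc) (inv_pos.2 hcL0).le
        (inv_pos.2 hM').le
    rw [abs_of_pos hc'] at b1
    rw [hfc, abs_mul, abs_mul]
    calc _ ≤ (c : ℝ)⁻¹ * (P * ((M : ℝ)⁻¹ * (c : ℝ)⁻¹)) :=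
          mul_le_mul b1 (mul_le_mul b2 (b3.trans b4) (abs_nonneg _) hP0) (by positivity)
            (by positivity)
      _ = _ := by ring
  have hleft : ∀ c : ℤ, c < -(M : ℤ) → |f c| ≤ (M : ℝ)⁻¹ * P * (|((c + L : ℤ) : ℝ)|⁻¹) ^ 2 := by
    intro c hc
    have b1 := abs_inv_pow_le (x := c) (by omega) ha
    have b1' : |(c : ℝ)|⁻¹ ≤ (M : ℝ)⁻¹ := by
      have : (M : ℝ) ≤ |(c : ℝ)| := by
        rw [← Int.cast_abs]
        exact_mod_cast (by rw [abs_of_neg (by omega)]; omega : (M : ℤ) ≤ |c|)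
      gcongr
    have b2 := abs_invMonomial_le h1' hk c (twoSided M) fun x hx => by
      have hx' := hlt x hx
      refine ⟨by omega, le_trans ?_ (inv_le_twoSided hx'.1 (by omega)).2.2.2⟩
      have h5 : (0 : ℝ) < (((M : ℤ) + 1 - x : ℤ) : ℝ) := by
        exact_mod_cast (by omega : 0 < (M : ℤ) + 1 - x)
      have h6 : (((M : ℤ) + 1 - x : ℤ) : ℝ) ≤ |((c + x : ℤ) : ℝ)| := by
        rw [← Int.cast_abs]
        exact_mod_cast (by rw [abs_of_neg (by omega)]; omega : (M : ℤ) + 1 - x ≤ |c + x|)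
      gcongr
    have b3 := abs_inv_pow_le_sq (x := c + L) (by omega) he
    rw [hfc, abs_mul, abs_mul]
    calc _ ≤ (M : ℝ)⁻¹ * (P * (|((c + L : ℤ) : ℝ)|⁻¹) ^ 2) :=
          mul_le_mul (b1.trans b1') (mul_le_mul b2 b3 (abs_nonneg _) hP0) (by positivity)
            (by positivity)
      _ = _ := by ring
  set D := (Finset.Icc (-(N : ℤ)) N).filter (fun c => (c < -(M : ℤ) ∨ (M : ℤ) - L < c)) with hD
  have hdiff : listSum (0 :: (t ++ [L])) (a :: (k ++ [e])) N -
      windowSum (t ++ [L]) (a :: (k ++ [e])) M = ∑ c ∈ D, f c := by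
    have hnz : ∀ c : ℤ, (c < -(M : ℤ) ∨ (M : ℤ) - L < c) → ∀ n ∈ 0 :: (t ++ [L]), c + n ≠ 0 := by
      intro c hc n hn
      simp only [List.mem_cons, List.mem_append, List.not_mem_nil, or_false] at hn
      rcases hn with rfl | hn | rfl
      · omega
      · have := hlt n hn; omega
      · omega
    have hw : ∀ c : ℤ, c ≤ (M : ℤ) - L ↔ ∀ n ∈ 0 :: (t ++ [L]), c + n ≤ M := by
      intro c
      simp only [List.mem_cons, List.mem_append, List.not_mem_nil, or_false]
      constructor
      · rintro hc n (rfl | hn | rfl)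
        · omega
        · have := hlt n hn; omega
        · omega
      · intro h
        have := h L (Or.inr (Or.inr rfl)); omega
    rw [sub_eq_iff_eq_add, listSum, windowSum, ← Finset.sum_union]
    · refine Finset.sum_congr ?_ fun c _ => rfl
      ext c
      have hw' := hw c
      have hnz' := hnz c
      have hsplit : (∀ n ∈ 0 :: (t ++ [L]), c + n ≠ 0 ∧ c + n ≤ M) ↔
          (∀ n ∈ 0 :: (t ++ [L]), c + n ≠ 0) ∧ c ≤ (M : ℤ) - L := by
        rw [hw]
        exact ⟨fun h => ⟨fun n hn => (h n hn).1, fun n hn => (h n hn).2⟩,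
          fun h n hn => ⟨h.1 n hn, h.2 n hn⟩⟩
      rw [Finset.mem_union, hD, Finset.mem_filter, Finset.mem_filter, Finset.mem_filter, hsplit,
        Finset.mem_Icc, Finset.mem_Icc]
      generalize (∀ n ∈ 0 :: (t ++ [L]), c + n ≠ 0) = Q at hnz' ⊢
      constructor
      · rintro ⟨h5, h6⟩
        by_cases h7 : c < -(M : ℤ) ∨ (M : ℤ) - L < c
        · exact Or.inl ⟨h5, h7⟩
        · exact Or.inr ⟨by omega, h6, by omega⟩
      · rintro (⟨h5, h6⟩ | ⟨h5, h6, h7⟩)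
        · exact ⟨h5, hnz' h6⟩
        · exact ⟨by omega, h6⟩
    · refine Finset.disjoint_left.2 fun c hc hc' => ?_
      rw [hD, Finset.mem_filter, Finset.mem_Icc] at hc
      rw [Finset.mem_filter, Finset.mem_Icc] at hc'
      have := (hw c).2 fun n hn => (hc'.2 n hn).2
      omega
  rw [hdiff]
  refine (Finset.abs_sum_le_sum_abs _ _).trans ?_
  have hD' : D ⊆ Finset.Ico (-(N : ℤ)) (-(M : ℤ)) ∪ Finset.Ioc ((M : ℤ) - L) N := by
    intro c hc
    simp only [hD, Finset.mem_filter, Finset.mem_Icc, Finset.mem_union, Finset.mem_Ico,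
      Finset.mem_Ioc] at hc ⊢
    omega
  have hdisj : Disjoint (Finset.Ico (-(N : ℤ)) (-(M : ℤ))) (Finset.Ioc ((M : ℤ) - L) N) :=
    Finset.disjoint_left.2 fun c hc hc' => by
      rw [Finset.mem_Ico] at hc; rw [Finset.mem_Ioc] at hc'; omega
  have hl : ∑ c ∈ Finset.Ico (-(N : ℤ)) (-(M : ℤ)), |f c| ≤
      (M : ℝ)⁻¹ * P * (2 * (((M : ℤ) + 1 - L : ℤ) : ℝ)⁻¹) := by
    refine (Finset.sum_le_sum fun c hc => hleft c (Finset.mem_Ico.1 hc).2).trans ?_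
    rw [← Finset.mul_sum]
    exact mul_le_mul_of_nonneg_left (sum_left_tail_le hL.2 N) (by positivity)
  have hr : ∑ c ∈ Finset.Ioc ((M : ℤ) - L) N, |f c| ≤
      (M : ℝ)⁻¹ * P * (2 * (((M : ℤ) + 1 - L : ℤ) : ℝ)⁻¹) := by
    refine (Finset.sum_le_sum fun c hc => hright c (Finset.mem_Ioc.1 hc).1).trans ?_
    rw [← Finset.mul_sum]
    refine mul_le_mul_of_nonneg_left ((sum_Ioc_inv_sq_le (by omega) _).trans_eq ?_) (by positivity)
    rw [show (M : ℤ) - L + 1 = M + 1 - L by ring]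
  calc ∑ c ∈ D, |f c| ≤ ∑ c ∈ Finset.Ico (-(N : ℤ)) (-(M : ℤ)) ∪ Finset.Ioc ((M : ℤ) - L) N, |f c| :=
        Finset.sum_le_sum_of_subset_of_nonneg hD' fun _ _ _ => abs_nonneg _
    _ ≤ (M : ℝ)⁻¹ * P * (2 * (((M : ℤ) + 1 - L : ℤ) : ℝ)⁻¹) +
        (M : ℝ)⁻¹ * P * (2 * (((M : ℤ) + 1 - L : ℤ) : ℝ)⁻¹) := by
        rw [Finset.sum_union hdisj]; exact add_le_add hl hr
    _ = 4 * (M : ℝ)⁻¹ * P * (((M : ℤ) + 1 - L : ℤ) : ℝ)⁻¹ := by ring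
    _ ≤ 4 * (M : ℝ)⁻¹ * P * twoSided M L := mul_le_mul_of_nonneg_left hL4 (by positivity)
    _ = _ := by
        rw [List.map_append, List.prod_append, ← hP]
        simp; ring

lemma abs_sum_pivotVal_sub_windowSum_le {a e : ℕ} {k : List ℕ} (ha : 0 < a) (hk : ∀ i ∈ k, 0 < i)
    (he : 2 ≤ e) {M : ℕ} (hM : 0 < M) {t : List ℤ} (ht : t ∈ chains (k.length + 1) 0 M) :
    |∑ j ∈ Finset.range (k.length + 2), pivotVal (0 :: t) (a :: (k ++ [e])) j -
      windowSum t (a :: (k ++ [e])) M| ≤ 4 / M * (t.map (twoSided M)).prod := by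
  have ht' := mem_chains.1 ht
  have h1 : Tendsto (listSum (0 :: t) (a :: (k ++ [e]))) atTop
      (𝓝 (∑ j ∈ Finset.range (k.length + 2), pivotVal (0 :: t) (a :: (k ++ [e])) j)) := by
    have h := tendsto_listSum (l := 0 :: t) (k := a :: (k ++ [e])) ?_ (by simp [ht'.1]) ?_ (by simp)
    · rwa [List.length_cons, ht'.1] at h
    · refine List.Pairwise.imp (fun h => ne_of_lt h) (List.pairwise_cons.2 ⟨?_, ht'.2.1⟩)
      exact fun x hx => (ht'.2.2 x hx).1
    · intro i hi
      simp only [List.mem_cons, List.mem_append, List.not_mem_nil, or_false] at hi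
      rcases hi with rfl | hi | rfl
      · exact ha
      · exact hk i hi
      · omega
  refine le_of_tendsto (h1.sub_const _).abs ?_
  filter_upwards [eventually_ge_atTop M] with N hN
  have hne : t ≠ [] := by rintro rfl; simp at ht'
  rw [← List.dropLast_append_getLast hne] at ht ⊢
  exact abs_listSum_sub_windowSum_le ha hk he hM hN ht

lemma sum_windowSum_negligible {a e : ℕ} {k : List ℕ} (ha : 0 < a) (hk : ∀ i ∈ k, 0 < i)
    (he : 2 ≤ e) : (fun M : ℕ => ∑ t ∈ chains (k.length + 1) 0 M,
      (∑ j ∈ Finset.range (k.length + 2), pivotVal (0 :: t) (a :: (k ++ [e])) j -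
      windowSum t (a :: (k ++ [e])) M)) ∈ negligible := by
  refine negligible_of_abs_le_div (4 * 2 ^ (k.length + 1)) (k.length + 1) (by positivity)
    fun M hM => ?_
  have hM' : (0 : ℝ) < M := by exact_mod_cast hM
  refine (Finset.abs_sum_le_sum_abs _ _).trans ((Finset.sum_le_sum fun t ht =>
    abs_sum_pivotVal_sub_windowSum_le ha hk he hM ht).trans ?_)
  rw [← Finset.mul_sum]
  have h := sum_chains_prod_le (k.length + 1) (a := 0) (b := M) (g := twoSided M) fun x hx => by
    rw [Finset.mem_Ioc] at hx
    have := inv_le_twoSided hx.1 hx.2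
    exact this.1.le.trans this.2.2.1
  rw [sum_twoSided, mul_pow] at h
  calc _ ≤ 4 / (M : ℝ) * (2 ^ (k.length + 1) * harm M ^ (k.length + 1)) :=
        mul_le_mul_of_nonneg_left h (by positivity)
    _ = _ := by ring

lemma invMonomial_negrev {p : List ℤ} {u : List ℕ} (h : p.length = u.length) :
    invMonomial (negrev p) u = (-1) ^ u.sum * invMonomial p u.reverse := by
  induction p generalizing u with
  | nil =>
    obtain rfl : u = [] := List.length_eq_zero_iff.1 h.symm
    simp [negrev]
  | cons x p ih =>
    have hu : u ≠ [] := by rintro rfl; simp at h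
    obtain ⟨v, f, rfl⟩ : ∃ u' f, u = u' ++ [f] :=
      ⟨_, _, (List.dropLast_append_getLast hu).symm⟩
    have h' : p.length = v.length := by simpa using h
    have h2 : negrev (x :: p) = negrev p ++ [-x] := by simp [negrev]
    rw [h2, invMonomial_append (by simpa using h'), ih h', List.reverse_append,
      List.reverse_singleton, List.singleton_append, invMonomial_cons, invMonomial_cons,
      List.sum_append, List.sum_singleton, pow_add, Int.cast_neg, inv_neg, neg_pow]
    simp only [invMonomial_nil]
    ring

lemma sum_compatPairs_invMonomial {i j : ℕ} {u : List ℕ} (hu : u.length = i + j) (M : ℕ) :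
    ∑ z ∈ compatPairs i j M, invMonomial (negrev z.1 ++ z.2) u =
      (-1) ^ (u.take i).sum * pairSum (u.take i).reverse (u.drop i) M := by
  have hi : (u.take i).length = i := by simp [hu]
  have hj : (u.drop i).length = j := by simp [hu]
  rw [pairSum, List.length_reverse, hi, hj, Finset.mul_sum]
  refine Finset.sum_congr rfl fun z hz => ?_
  have hz' := mem_compatPairs.1 hz
  conv_lhs => rw [← List.take_append_drop i u]
  rw [invMonomial_append (by rw [length_negrev, hz'.1.1, hi]),
    invMonomial_negrev (by rw [hz'.1.1, hi]), mul_assoc]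

lemma neg_one_pow_mul_mem {S : Submodule ℚ (ℕ → ℝ)} {f : ℕ → ℝ} (hf : f ∈ S) (n : ℕ) :
    (fun M => (-1) ^ n * f M) ∈ S := by
  convert S.smul_mem ((-1 : ℚ) ^ n) hf using 1
  ext M
  simp [Rat.smul_def]

lemma sum_compatPairs_mem {i j : ℕ} {u : List ℕ} (hu : u.length = i + j) (hpos : ∀ x ∈ u, 0 < x)
    (hlast : 2 ≤ (u.drop i).getLastD 2) :
    (fun M => ∑ z ∈ compatPairs i j M, invMonomial (negrev z.1 ++ z.2) u) ∈
      asympSpan (i + j) u.sum := by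
  simp only [sum_compatPairs_invMonomial hu]
  refine neg_one_pow_mul_mem ?_ _
  have h1 : ∀ x ∈ (u.take i).reverse, 0 < x := fun x hx =>
    hpos x (List.mem_of_mem_take (List.mem_reverse.1 hx))
  have h2 : Admissible (u.drop i) := ⟨fun x hx => hpos x (List.mem_of_mem_drop hx), hlast⟩
  have h3 := mem_asympSpan_of_negligible (pairSum_sub_negligible h1 h2) (i + j) u.sum
  have h4 := mul_mem_asympSpan (hseq_mem _ h1) (hseq_mem _ h2.1)
  have hs : (u.take i).sum + (u.drop i).sum = u.sum := by
    rw [← List.sum_append, List.take_append_drop]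
  have h5 := asympSpan_mono (d' := i + j) (w' := u.sum) (by simp; omega)
    (by rw [List.sum_reverse]; exact hs.le) h4
  convert Submodule.add_mem _ h3 h5 using 1
  ext M; simp

lemma two_le_getLastD_drop {k : List ℕ} (h : 2 ≤ k.getLastD 2) (n : ℕ) :
    2 ≤ (k.drop n).getLastD 2 := by
  induction n generalizing k with
  | zero => simpa using h
  | succ n ih =>
    cases k with
    | nil => simp
    | cons x k => simpa using ih (two_le_getLastD_tail h)

lemma two_le_getLastD_of_forall₂ {k u : List ℕ} (h : List.Forall₂ (· ≤ ·) k u)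
    (hk : 2 ≤ k.getLastD 2) : 2 ≤ u.getLastD 2 := by
  induction h with
  | nil => simp
  | @cons x y k u hxy h ih =>
    cases h with
    | nil => exact le_trans (by simpa using hk) hxy
    | cons _ _ =>
      rw [getLastD_cons_self _ _ _ (by simp)] at hk ⊢
      exact ih hk

lemma pos_of_forall₂ {k u : List ℕ} (h : List.Forall₂ (· ≤ ·) k u)
    (hk : ∀ i ∈ k, 0 < i) : ∀ i ∈ u, 0 < i := by
  induction h with
  | nil => simp
  | cons hxy _ ih =>
    simp only [List.mem_cons, forall_eq_or_imp] at hk ⊢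
    exact ⟨hk.1.trans_le hxy, ih hk.2⟩

lemma sum_compatPairs_mem_of_monomialSpan {i j m : ℕ} {k : List ℕ} (hk : k.length = i + j)
    (hpos : ∀ x ∈ k, 0 < x) (hlast : 2 ≤ (k.drop i).getLastD 2) {H : List ℤ → ℝ}
    (hH : H ∈ monomialSpan k m) :
    (fun M => ∑ z ∈ compatPairs i j M, H (negrev z.1 ++ z.2)) ∈ asympSpan (i + j) (k.sum + m) := by
  have hlen : ∀ {M : ℕ} {z}, z ∈ compatPairs i j M → (negrev z.1 ++ z.2).length = k.length := by
    intro M z hz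
    have hz' := mem_compatPairs.1 hz
    simp [hz'.1.1, hz'.2.1.1, hk]
  induction hH using Submodule.span_induction with
  | mem H hH =>
    rcases hH with h | ⟨u, h1, h2, h3⟩
    · convert Submodule.zero_mem _ using 1
      ext M
      exact Finset.sum_eq_zero fun z hz => h _ (hlen hz)
    · have h4 := sum_compatPairs_mem (h1.length_eq.symm.trans hk) (pos_of_forall₂ h1 hpos)
        (two_le_getLastD_of_forall₂ (List.forall₂_drop i h1) hlast)
      rw [← h2]
      convert h4 using 1
      ext M
      exact Finset.sum_congr rfl fun z hz => h3 _ (hlen hz)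
  | zero => convert Submodule.zero_mem _ using 1; ext M; simp
  | add H H' _ _ h h' =>
    convert Submodule.add_mem _ h h' using 1
    ext M; simp [Finset.sum_add_distrib]
  | smul c H _ h =>
    convert Submodule.smul_mem _ c h using 1
    ext M; simp [Finset.smul_sum]

lemma sum_pivotVal_mem {k : List ℕ} (hk : Admissible k) {i j : ℕ} (hij : k.length = i + j + 1) :
    (fun M : ℕ => ∑ t ∈ chains (i + j) 0 M, pivotVal (0 :: t) k i) ∈ asympSpan (i + j) k.sum := by
  have hi : i < k.length := by omega
  have hsum : k.getD i 0 + (k.eraseIdx i).sum = k.sum := by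
    rw [List.getD_eq_getElem _ _ hi]
    simp
  have h1 : (fun M : ℕ => ∑ t ∈ chains (i + j) 0 M, pivotVal (0 :: t) k i) =
      ∑ p ∈ Finset.HasAntidiagonal.antidiagonal (k.getD i 0), (fun _ => beta p.1) *
        (fun M => ∑ z ∈ compatPairs i j M, (fun l => PowerSeries.coeff p.2
          (zpow (fun n => invLin n) l (k.eraseIdx i))) (negrev z.1 ++ z.2)) := by
    ext M
    rw [sum_chains_eq_sum_compatPairs i j M (fun l => pivotVal l k i)
      fun l c hl => pivotVal_map_add l c k (by omega), Finset.sum_apply]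
    simp only [Pi.mul_apply, Finset.mul_sum]
    rw [Finset.sum_comm]
    refine Finset.sum_congr rfl fun z hz => ?_
    have hz' := (mem_compatPairs.1 hz).1.1
    have h := pivotVal_append (negrev z.1) z.2 k
    rw [length_negrev, hz'] at h
    rw [h, PowerSeries.coeff_mul]
    refine Finset.sum_congr rfl fun p _ => ?_
    rw [betaSeries, PowerSeries.coeff_mk]
  rw [h1]
  refine Submodule.sum_mem _ fun p hp => ?_
  rw [Finset.HasAntidiagonal.mem_antidiagonal] at hp
  have hdrop : (k.eraseIdx i).drop i = k.drop (i + 1) := by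
    rw [List.eraseIdx_eq_take_drop_succ]
    exact List.drop_left' (by simp; omega)
  have h2 := sum_compatPairs_mem_of_monomialSpan (i := i) (j := j) (k := k.eraseIdx i)
    (by rw [List.length_eraseIdx]; simp [hi]; omega)
    (fun x hx => hk.1 x (List.mem_of_mem_eraseIdx hx))
    (by rw [hdrop]; exact two_le_getLastD_drop hk.2 _)
    (coeff_zpow_invLin_mem (k.eraseIdx i) p.2)
  exact asympSpan_mono (by omega) (by omega)
    (mul_mem_asympSpan (const_mem_asympSpan (beta_mem p.1)) h2)

/-- The sum of the signed monomial `k` over all chains of diameter at most `M` avoiding zero. -/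
noncomputable def narrowSum (k : List ℕ) (M : ℕ) : ℝ :=
  ∑ l ∈ narrowChains k.length M with (0 : ℤ) ∉ l, invMonomial l k

lemma narrowSum_mem {k : List ℕ} (hk : Admissible k) (h2 : 2 ≤ k.length) :
    narrowSum k ∈ asympSpan (k.length - 1) k.sum := by
  obtain ⟨k, e, rfl, he⟩ := exists_eq_append_of_getLastD hk.2 (by rintro rfl; simp at h2)
  cases k with
  | nil => simp at h2
  | cons a k =>
    have h1 := mem_asympSpan_of_negligible (sum_windowSum_negligible (k := k) (hk.1 a (by simp))
      (fun i hi => hk.1 i (by simp [hi])) he) (k.length + 1) (a :: (k ++ [e])).sum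
    have h3 : ∀ j ∈ Finset.range (k.length + 2), (fun M : ℕ => ∑ t ∈ chains (k.length + 1) 0 M,
        pivotVal (0 :: t) (a :: (k ++ [e])) j) ∈
          asympSpan (k.length + 1) (a :: (k ++ [e])).sum := by
      intro j hj
      rw [Finset.mem_range] at hj
      have h := sum_pivotVal_mem hk (i := j) (j := k.length + 1 - j) (by simp; omega)
      rwa [show j + (k.length + 1 - j) = k.length + 1 by omega] at h
    have h4 := Submodule.sub_mem _ (Submodule.sum_mem _ h3) h1
    convert h4 using 1
    · simp
    · ext M
      rw [narrowSum, show (a :: k ++ [e]).length = k.length + 1 + 1 by simp,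
        sum_narrowChains_eq_sum_window, Pi.sub_apply, Finset.sum_apply, Finset.sum_comm,
        ← Finset.sum_sub_distrib]
      refine Finset.sum_congr rfl fun t _ => ?_
      rw [sub_sub_cancel]
      rfl

lemma narrowSum_eq (k : List ℕ) (M : ℕ) : narrowSum k M = ∑ i ∈ Finset.range (k.length + 1),
    (-1) ^ (k.take i).sum * pairSum (k.take i).reverse (k.drop i) M := by
  rw [narrowSum, sum_narrowChains_ne_zero]
  refine Finset.sum_congr rfl fun i hi => ?_
  rw [Finset.mem_range] at hi
  exact sum_compatPairs_invMonomial (by omega) M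

lemma hseq_add_neg_one_pow_sum_mem {k : List ℕ} (hk : Admissible k) (h2 : 2 ≤ k.length)
    (hm : Mismatched k)
    (hd : ∀ l : List ℕ, (∀ i ∈ l, 0 < i) → l.length < k.length → Mismatched l → IsLower l) :
    hseq k + (fun M => (-1) ^ k.sum * hseq k.reverse M) ∈ asympSpan (k.length - 1) k.sum := by
  have h1 : ∀ i ∈ Finset.range (k.length - 1), (fun M => (-1) ^ (k.take (i + 1)).sum *
      pairSum (k.take (i + 1)).reverse (k.drop (i + 1)) M) ∈ asympSpan (k.length - 1) k.sum := by
    intro i hi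
    rw [Finset.mem_range] at hi
    refine neg_one_pow_mul_mem ?_ _
    have hs : (k.take (i + 1)).sum + (k.drop (i + 1)).sum = k.sum := by
      rw [← List.sum_append, List.take_append_drop]
    have hu : ∀ x ∈ (k.take (i + 1)).reverse, 0 < x := fun x hx =>
      hk.1 x (List.mem_of_mem_take (List.mem_reverse.1 hx))
    have hv : Admissible (k.drop (i + 1)) :=
      ⟨fun x hx => hk.1 x (List.mem_of_mem_drop hx), two_le_getLastD_drop hk.2 _⟩
    have h3 := mem_asympSpan_of_negligible (pairSum_sub_negligible hu hv) (k.length - 1) k.sum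
    have h4 := hseq_mul_hseq_mem hd hu hv.1
      (List.ne_nil_of_length_pos (by simp; omega)) (List.ne_nil_of_length_pos (by simp; omega))
      (by simp; omega) (by rw [List.sum_reverse, hs]; exact hm)
    rw [List.sum_reverse, hs] at h4
    convert Submodule.add_mem _ h3 h4 using 1
    simp
  convert Submodule.sub_mem _ (narrowSum_mem hk h2) (Submodule.sum_mem _ h1) using 1
  ext M
  obtain ⟨n, hn⟩ : ∃ n, k.length = n + 1 := ⟨k.length - 1, by omega⟩
  rw [Pi.sub_apply, narrowSum_eq, Finset.sum_range_succ', hn, Finset.sum_range_succ,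
    Finset.sum_apply, ← hn, List.take_length, List.drop_length, pairSum_nil_right]
  simp only [List.take_zero, List.drop_zero, List.reverse_nil, List.sum_nil, pow_zero, one_mul,
    pairSum_nil_left, Pi.add_apply, hn, Nat.add_sub_cancel]
  ring

lemma Admissible.isLower {k : List ℕ} (hk : Admissible k) (hm : Mismatched k)
    (hd : ∀ l : List ℕ, (∀ i ∈ l, 0 < i) → l.length < k.length → Mismatched l → IsLower l) :
    IsLower k := by
  have hm' := hm
  unfold Mismatched at hm'
  rcases lt_or_ge k.length 2 with h | h
  · match k, h with
    | [], _ => simp at hm'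
    | [s], _ =>
      simp only [List.sum_singleton, List.length_singleton] at hm'
      have hs := hk.1 s (by simp)
      have h1 := const_mem_asympSpan
        (MZV_singleton_mem (s := s) (Nat.even_iff.2 (by omega)) hs.ne')
      have h2 := mem_asympSpan_of_negligible hk.sub_negligible 0 s
      change hseq [s] ∈ asympSpan 0 s
      convert Submodule.sub_mem _ h1 h2 using 1
      ext M; simp [hseq]
  · have h1 := hseq_add_neg_one_pow_sum_mem hk h hm hd
    have h2 := hseq_add_reverse_mem hk.1 (by rintro rfl; simp at h) hm hd
    unfold IsLower
    convert Submodule.smul_mem _ (2⁻¹ : ℚ) (Submodule.add_mem _ h1 h2) using 1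
    have hsign : (-1 : ℝ) ^ k.sum = -(-1) ^ k.length := by
      rcases Nat.even_or_odd k.length with h3 | h3
      · rw [h3.neg_one_pow, Odd.neg_one_pow]
        rw [Nat.even_iff] at h3; rw [Nat.odd_iff]; omega
      · rw [h3.neg_one_pow, Even.neg_one_pow, neg_neg]
        rw [Nat.odd_iff] at h3; rw [Nat.even_iff]; omega
    ext M
    simp only [Pi.add_apply, Pi.smul_apply, Rat.smul_def, hsign]
    push_cast
    ring

lemma Mismatched.isLower {k : List ℕ} (hm : Mismatched k) (hk : ∀ i ∈ k, 0 < i) : IsLower k := by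
  induction hn : k.length using Nat.strong_induction_on generalizing k with
  | _ n ih =>
    refine isLower_of_admissible n (fun l hl hln hlm => ?_) k hk hn hm
    exact hl.isLower hlm fun t ht htl htm => ih _ (hln ▸ htl) htm ht rfl

lemma two_le_getLastD {k : List ℕ} (hne : k ≠ []) (h : 2 ≤ k.getLastD 0) : 2 ≤ k.getLastD 2 := by
  cases k with
  | nil => exact absurd rfl hne
  | cons x k => simpa [List.getLastD] using h

end MZVParity

/-- Parity theorem: if `k₁,…,k_d` are positive integers with `k_d ≥ 2` and
`k₁+⋯+k_d ≢ d (mod 2)`, then `ζ(k₁,…,k_d)` lies in the `ℚ[π²]`-span of the multiple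
zeta values of depth at most `d − 1` and weight at most `k₁+⋯+k_d`. -/
theorem parity_theorem (k : List ℕ) (hk : ∀ i ∈ k, 0 < i) (hne : k ≠ [])
    (hlast : 2 ≤ k.getLastD 0) (hpar : k.sum % 2 ≠ k.length % 2) :
    MZV k ∈ Submodule.span ℚ {x : ℝ | ∃ (a : ℕ) (l : List ℕ),
      l.length ≤ k.length - 1 ∧ (∀ i ∈ l, 0 < i) ∧ 2 ≤ l.getLastD 2 ∧
      2 * a + l.sum ≤ k.sum ∧ x = π ^ (2 * a) * MZV l} := by
  have h := (show MZVParity.Mismatched k from hpar).isLower hk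
  exact MZVParity.Admissible.MZV_mem ⟨hk, MZVParity.two_le_getLastD hne hlast⟩ h
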